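/- Suppose the delayed mass-action system is a DeCBMAS and the network is a combination of ℓ subnetworks each of which is a 2d sub-DeCBMAS. Assume that every nontrivial semilocking set W of the combined network satisfies at least one of the following: (a) W ∩ S_c = ∅; (b) for every p the set W^(p) is either a facet-type semilocking set of subnetwork p or empty; (c) every species of S ∖ W belongs to W^{tf} ∪ W^{tr} and W^{tf} ≠ ∅. Then the system is persistent. -/

import Mathlib

open Finset Filter

variable {n r : ℕ}

/-- Mass-action monomial `x^y = ∏ j, x j ^ y j`. -/
def mono (x : Fin n → ℝ) (y : Fin n → ℕ) : ℝ := ∏ j, x j ^ y j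

/-- A (bounded-domain) solution of the delayed mass-action system whose reactions are
those in the index set `R` (with reactant complexes `y`, product complexes `y'`,
rate constants `k`, delays `τ`, and maximal delay `τm`):
nonnegative, continuous on `[-τm, ∞)`, and satisfying the delay differential equation
`x'(t) = ∑ i ∈ R, k i (x(t-τ i)^{y i} • y' i - x(t)^{y i} • y i)` for `t > 0`. -/
def IsSolutionOn (y y' : Fin r → Fin n → ℕ) (k τ : Fin r → ℝ) (τm : ℝ)
    (R : Finset (Fin r)) (x : ℝ → Fin n → ℝ) : Prop :=
  (∀ t ∈ Set.Ici (-τm), ∀ j, 0 ≤ x t j) ∧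
  ContinuousOn x (Set.Ici (-τm)) ∧
  ∀ t > (0 : ℝ), HasDerivAt x
    (fun j => ∑ i ∈ R, k i * (mono (x (t - τ i)) (y i) * (y' i j : ℝ)
      - mono (x t) (y i) * (y i j : ℝ))) t

/-- A solution of the full delayed mass-action system. -/
def IsSolution (y y' : Fin r → Fin n → ℕ) (k τ : Fin r → ℝ) (τm : ℝ)
    (x : ℝ → Fin n → ℝ) : Prop :=
  IsSolutionOn y y' k τ τm Finset.univ x

/-- Positive initial condition: `x` is strictly positive on `[-τm, 0]`. -/
def PosInit (τm : ℝ) (x : ℝ → Fin n → ℝ) : Prop :=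
  ∀ t ∈ Set.Icc (-τm) 0, ∀ j, 0 < x t j

/-- The solution is bounded on `[-τm, ∞)`. -/
def BoundedSol (τm : ℝ) (x : ℝ → Fin n → ℝ) : Prop :=
  ∃ M : ℝ, ∀ t ∈ Set.Ici (-τm), ‖x t‖ ≤ M

/-- The (sub)system consisting of the reactions in `R` is complex balanced:
there is a positive state `xb` at which, for every complex `η`, the inflow and
outflow rates of `η` coincide. -/
def ComplexBalancedOn (y y' : Fin r → Fin n → ℕ) (k : Fin r → ℝ)
    (R : Finset (Fin r)) : Prop :=
  ∃ xb : Fin n → ℝ, (∀ j, 0 < xb j) ∧ ∀ η : Fin n → ℕ,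
    ∑ i ∈ R.filter (fun i => y i = η), k i * mono xb (y i)
      = ∑ i ∈ R.filter (fun i => y' i = η), k i * mono xb (y i)

/-- `W` is a semilocking set for the reactions in `R`. -/
def Semilocking (y y' : Fin r → Fin n → ℕ) (R : Finset (Fin r)) (W : Set (Fin n)) : Prop :=
  W.Nonempty ∧ ∀ i ∈ R, (∃ j ∈ W, y' i j ≠ 0) → ∃ j ∈ W, y i j ≠ 0

/-- Stoichiometric subspace spanned by the reaction vectors of the reactions in `R`. -/
def stoichOn (y y' : Fin r → Fin n → ℕ) (R : Finset (Fin r)) : Submodule ℝ (Fin n → ℝ) :=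
  Submodule.span ℝ {v | ∃ i ∈ R, v = fun j => (y' i j : ℝ) - (y i j : ℝ)}

/-- `W` is vertex-type w.r.t. the subspace `V`: the only `v ∈ V` vanishing on `W` is `0`. -/
def VertexType (V : Submodule ℝ (Fin n → ℝ)) (W : Set (Fin n)) : Prop :=
  ∀ v ∈ V, (∀ j ∈ W, v j = 0) → v = 0

/-- `W` is facet-type w.r.t. the subspace `V`: the projection of `V` onto the
coordinates outside `W` has dimension `dim V - 1`. -/
def FacetType (V : Submodule ℝ (Fin n → ℝ)) (W : Set (Fin n)) : Prop :=
  Module.finrank ℝ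
      (V.map (LinearMap.funLeft ℝ ℝ (Subtype.val : {j : Fin n // j ∉ W} → Fin n)))
    = Module.finrank ℝ V - 1

/-- The network is a combination of subnetworks with species sets `Sp p` and with
reaction `i` assigned to subnetwork `grp i`. -/
def IsCombination {l : ℕ} (y y' : Fin r → Fin n → ℕ) (Sp : Fin l → Set (Fin n))
    (grp : Fin r → Fin l) : Prop :=
  (∀ j, ∃ p, j ∈ Sp p) ∧ ∀ i j, (y i j ≠ 0 ∨ y' i j ≠ 0) → j ∈ Sp (grp i)

/-- The reaction index set of subnetwork `p`. -/
def Rgrp {l : ℕ} (grp : Fin r → Fin l) (p : Fin l) : Finset (Fin r) :=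
  Finset.univ.filter (fun i => grp i = p)

/-- The set `S_c` of intersecting species. -/
def interSpecies {l : ℕ} (Sp : Fin l → Set (Fin n)) : Set (Fin n) :=
  {j | ∃ p q, p ≠ q ∧ j ∈ Sp p ∧ j ∈ Sp q}

/-- `W^{cn}`: species outside `W` lying in some subnetwork `p'` with `W ∩ S^(p') = ∅`. -/
def Wcn {l : ℕ} (Sp : Fin l → Set (Fin n)) (W : Set (Fin n)) : Set (Fin n) :=
  {j | j ∉ W ∧ ∃ p, W ∩ Sp p = ∅ ∧ j ∈ Sp p}

/-- `W^{tf}`: completely unrestricted species outside `W`: they occur in some reaction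
all of whose species lie outside `W`. -/
def Wtf (y y' : Fin r → Fin n → ℕ) (W : Set (Fin n)) : Set (Fin n) :=
  {j | j ∉ W ∧ ∃ i, (y i j ≠ 0 ∨ y' i j ≠ 0) ∧
    ∀ j', (y i j' ≠ 0 ∨ y' i j' ≠ 0) → j' ∉ W}

/-- `W^{tr}`: totally restricted species outside `W`: every stoichiometric vector
vanishing on `W` also vanishes at `j`. -/
def Wtr (y y' : Fin r → Fin n → ℕ) (W : Set (Fin n)) : Set (Fin n) :=
  {j | j ∉ W ∧ ∀ v ∈ stoichOn y y' Finset.univ, (∀ j' ∈ W, v j' = 0) → v j = 0}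

/-- `θ` (a function on `[-τm,0]`) is an ω-limit point of the solution `x`. -/
def OmegaLimitPt (τm : ℝ) (x θ : ℝ → Fin n → ℝ) : Prop :=
  ContinuousOn θ (Set.Icc (-τm) 0) ∧ (∀ s ∈ Set.Icc (-τm) 0, ∀ j, 0 ≤ θ s j) ∧
  ∃ tN : ℕ → ℝ, Tendsto tN atTop atTop ∧
    ∀ ε > (0 : ℝ), ∃ N₀, ∀ N ≥ N₀, ∀ s ∈ Set.Icc (-τm) 0, ‖x (tN N + s) - θ s‖ < ε

/-- `θ` lies on the boundary `L_W`: it vanishes identically on the coordinates of `W`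
and is nowhere zero on the coordinates outside `W`. -/
def OnBoundary (τm : ℝ) (W : Set (Fin n)) (θ : ℝ → Fin n → ℝ) : Prop :=
  (∀ s ∈ Set.Icc (-τm) 0, ∀ j ∈ W, θ s j = 0) ∧
  ∀ s ∈ Set.Icc (-τm) 0, ∀ j ∉ W, θ s j ≠ 0

/-- Persistence of the delayed mass-action system: every bounded solution with
positive initial condition has `liminf_{t→∞} x_j(t) > 0` for every species `j`. -/
def Persistent (y y' : Fin r → Fin n → ℕ) (k τ : Fin r → ℝ) (τm : ℝ) : Prop :=
  ∀ x : ℝ → Fin n → ℝ, IsSolution y y' k τ τm x → PosInit τm x → BoundedSol τm x →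
    ∀ j, 0 < liminf (fun t => x t j) atTop



theorem gac_slopes (Res : Set ℝ) (b0 d ε : ℝ) (hd : 0 < d) (hε : 2 * d ≤ ε) (hb : b0 ∈ Res)
    (hsep : ∀ r ∈ Res, ∀ r' ∈ Res, r = r' ∨ 2 * ε < |r - r'|) :
    ∃ ν dd : ℕ → ℝ, ν 0 = b0 ∧ Monotone ν ∧ (∀ i : ℕ, |b0 + i * d - ν i| ≤ dd i - 2 * d) ∧
      (∀ i, (ν i ∈ Res ∧ dd i = 3 * ε) ∨ (dd i = 2 * d ∧ ∀ r ∈ Res, ε < |ν i - r|)) ∧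
      (∀ l : ℕ, ν l < ν (l + 1) → ε ≤ ((l : ℝ) + 1) * d) := by
  have key : ∀ β : ℝ, ∃ p : ℝ × ℝ, (p.1 ∈ Res ∧ |β - p.1| ≤ ε ∧ p.2 = 3 * ε) ∨
      (p.1 = β ∧ p.2 = 2 * d ∧ ∀ r ∈ Res, ε < |β - r|) := by
    intro β
    by_cases h : ∃ r ∈ Res, |β - r| ≤ ε
    · obtain ⟨r, hr, h1⟩ := h
      exact ⟨(r, 3 * ε), Or.inl ⟨hr, h1, rfl⟩⟩
    · push Not at h
      exact ⟨(β, 2 * d), Or.inr ⟨rfl, rfl, h⟩⟩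
  choose f hf using key
  have hnear : ∀ β, ∀ r ∈ Res, |β - r| ≤ ε → (f β).1 = r := by
    intro β r hr h
    rcases hf β with ⟨h1, h2, _⟩ | ⟨_, _, h3⟩
    · rcases hsep _ h1 _ hr with h4 | h4
      · exact h4
      · exfalso
        rw [abs_le] at h h2
        rcases lt_abs.mp h4 with h5 | h5 <;> linarith
    · exact absurd h (not_le.mpr (h3 r hr))
  have hmono : Monotone (fun β => (f β).1) := by
    intro β β' hbb
    show (f β).1 ≤ (f β').1
    rcases hf β with ⟨h1, h2, _⟩ | ⟨h1, _, h3⟩ <;> rcases hf β' with ⟨h1', h2', _⟩ | ⟨h1', _, h3'⟩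
    · rcases hsep _ h1 _ h1' with h4 | h4
      · exact h4.le
      · rw [abs_le] at h2 h2'
        rcases lt_abs.mp h4 with h5 | h5 <;> linarith
    · have h6 := h3' _ h1
      rw [abs_le] at h2
      rw [h1']
      rcases lt_abs.mp h6 with h5 | h5 <;> linarith
    · have h6 := h3 _ h1'
      rw [abs_le] at h2'
      rw [h1]
      rcases lt_abs.mp h6 with h5 | h5 <;> linarith
    · rw [h1, h1']; exact hbb
  have hgrid : Monotone (fun i : ℕ => b0 + (i : ℝ) * d) := by
    intro i j hij
    have : (i : ℝ) ≤ j := by exact_mod_cast hij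
    show b0 + (i : ℝ) * d ≤ b0 + (j : ℝ) * d
    nlinarith
  refine ⟨fun i => (f (b0 + i * d)).1, fun i => (f (b0 + i * d)).2, ?_, hmono.comp hgrid, ?_, ?_, ?_⟩
  · apply hnear _ _ hb
    simp; linarith
  · intro i
    show |b0 + i * d - (f (b0 + i * d)).1| ≤ (f (b0 + i * d)).2 - 2 * d
    rcases hf (b0 + i * d) with ⟨_, h2, h3⟩ | ⟨h1, h2, _⟩
    · rw [h3]; linarith
    · rw [h1, h2]; simp
  · intro i
    rcases hf (b0 + i * d) with ⟨h1, h2, h3⟩ | ⟨h1, h2, h3⟩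
    · exact Or.inl ⟨h1, h3⟩
    · refine Or.inr ⟨h2, ?_⟩
      show ∀ r ∈ Res, ε < |(f (b0 + i * d)).1 - r|
      rw [h1]; exact h3
  · intro l hl
    by_contra hcon
    push Not at hcon
    have hl0 : (0 : ℝ) ≤ l := Nat.cast_nonneg l
    have e1 : (f (b0 + (l : ℝ) * d)).1 = b0 := by
      apply hnear _ _ hb
      rw [add_sub_cancel_left, abs_of_nonneg (by positivity)]; nlinarith
    have e2 : (f (b0 + ((l + 1 : ℕ) : ℝ) * d)).1 = b0 := by
      apply hnear _ _ hb
      rw [add_sub_cancel_left, abs_of_nonneg (by positivity)]; push_cast; nlinarith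
    simp only [e1, e2] at hl
    exact lt_irrefl _ hl

theorem gac_up (ν w : ℕ → ℝ) (hν : Monotone ν) (i N : ℕ) (hiN : i ≤ N) :
    (ν N = ν i ∧ ∑ l ∈ range N, (ν (l+1) - ν l) * w l = ∑ l ∈ range i, (ν (l+1) - ν l) * w l) ∨
    ∃ l, i ≤ l ∧ l < N ∧ ν l = ν i ∧ ν l < ν (l+1) ∧
      ∑ q ∈ range (l+1), (ν (q+1) - ν q) * w q
        = ∑ q ∈ range i, (ν (q+1) - ν q) * w q + (ν (l+1) - ν i) * w l := by
  induction N, hiN using Nat.le_induction with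
  | base => exact Or.inl ⟨rfl, rfl⟩
  | succ N hN ih =>
    rcases ih with ⟨h1, h2⟩ | ⟨l, h1, h2, h3⟩
    · rcases (hν (Nat.le_succ N)).eq_or_lt with h | h
      · left
        refine ⟨by rw [← h1]; exact h.symm, ?_⟩
        rw [sum_range_succ, h2]
        have : ν (N+1) = ν N := h.symm
        rw [this]; ring
      · right
        refine ⟨N, hN, Nat.lt_succ_self N, h1, h, ?_⟩
        rw [sum_range_succ, h2, h1]
    · exact Or.inr ⟨l, h1, h2.trans (Nat.lt_succ_self N), h3⟩

theorem gac_down (ν w : ℕ → ℝ) (hν : Monotone ν) (i : ℕ) :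
    ν i = ν 0 ∨
    ∃ l, l < i ∧ ν l < ν (l+1) ∧ ν (l+1) = ν i ∧
      ∑ q ∈ range i, (ν (q+1) - ν q) * w q
        = ∑ q ∈ range l, (ν (q+1) - ν q) * w q + (ν i - ν l) * w l := by
  induction i with
  | zero => exact Or.inl rfl
  | succ N ih =>
    rcases (hν (Nat.le_succ N)).eq_or_lt with h | h
    · have h' : ν (N+1) = ν N := h.symm
      rcases ih with h1 | ⟨l, h1, h2, h3, h4⟩
      · left; rw [h', h1]
      · right
        refine ⟨l, h1.trans (Nat.lt_succ_self N), h2, by rw [h3, h'], ?_⟩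
        rw [sum_range_succ, h4, h']; ring
    · right
      exact ⟨N, Nat.lt_succ_self N, h, rfl, by rw [sum_range_succ]⟩

theorem gac_gap (ν : ℕ → ℝ) (N : ℕ) : ∃ γ > 0, ∀ l < N, ν l < ν (l+1) → γ ≤ ν (l+1) - ν l := by
  induction N with
  | zero => exact ⟨1, one_pos, fun l hl => absurd hl (Nat.not_lt_zero l)⟩
  | succ N ih =>
    obtain ⟨γ, hγ, h⟩ := ih
    by_cases h1 : ν N < ν (N+1)
    · refine ⟨min γ (ν (N+1) - ν N), lt_min hγ (sub_pos.mpr h1), fun l hl hlt => ?_⟩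
      rcases Nat.lt_succ_iff_lt_or_eq.mp hl with h2 | h2
      · exact (min_le_left _ _).trans (h l h2 hlt)
      · subst h2; exact min_le_right _ _
    · refine ⟨γ, hγ, fun l hl hlt => ?_⟩
      rcases Nat.lt_succ_iff_lt_or_eq.mp hl with h2 | h2
      · exact h l h2 hlt
      · subst h2; exact absurd hlt h1

theorem gac_expLarge (A γ d : ℝ) (hγ : 0 < γ) (hd : 0 < d) :
    ∃ T0 : ℝ, 0 ≤ T0 ∧ ∀ T ≥ T0, A ≤ γ * Real.exp (T * d) := by
  refine ⟨|A| / (γ * d), by positivity, fun T hT => ?_⟩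
  have h1 : T * d + 1 ≤ Real.exp (T * d) := Real.add_one_le_exp _
  have h2 : |A| ≤ T * (γ * d) := by rwa [ge_iff_le, div_le_iff₀ (by positivity)] at hT
  have h3 := le_abs_self A
  nlinarith


def gdot (m : ℕ) (v : ℕ → ℤ) (a : ℕ → ℝ) : ℝ := ∑ i ∈ range m, (v i : ℝ) * a i

structure GTail (m k : ℕ) (H0 : Set (ℕ → ℤ)) (K d Ω Λ T : ℝ) (pre : ℕ → ℝ)
    (L : Set ((ℕ → ℝ) × ℝ × ℝ)) : Prop where
  fin : L.Finite
  tie : ∃ e ∈ L, (∀ i < k, e.1 i = pre i) ∧ (∀ q, k ≤ q → q < m → e.1 q = pre (k-1)) ∧ e.2.1 = 0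
  pref : ∀ e ∈ L, ∀ i < k, e.1 i = pre i
  mon : ∀ e ∈ L, ∀ i, k ≤ i → i < m → e.1 (i-1) ≤ e.1 i
  bdd : ∀ e ∈ L, ∀ i, k ≤ i → i < m → e.1 i ≤ Λ
  C0 : ∀ e ∈ L, 0 ≤ e.2.1
  C1 : ∀ e ∈ L, e.2.1 ≤ Λ * Real.exp (-(T * (pre (k-1) + 2 * d)))
  dle : ∀ e ∈ L, d ≤ e.2.2
  coh : ∀ e ∈ L, ∀ v ∈ H0, gdot m v e.1 = 0 ∨ K * e.2.2 ≤ |gdot m v e.1|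
  S : ∀ e ∈ L, ∀ p, k ≤ p → p < m → Ω ≤ e.1 p + e.2.2 ∨
    ∃ e' ∈ L, (∀ i < p, e'.1 i = e.1 i) ∧ ∃ ν ≤ Λ, (∀ q, p ≤ q → q < m → e'.1 q = ν) ∧
      e.2.1 + Real.exp (-(T * (e.1 p + e.2.2))) ≤ e'.2.1
  S' : ∀ e ∈ L, ∀ p, k ≤ p → p < m → e.1 p = e.1 (p-1) ∨
    ∃ e' ∈ L, (∀ i < p, e'.1 i = e.1 i) ∧ ∃ ν < e.1 p, (∀ q, p ≤ q → q < m → e'.1 q = ν) ∧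
      e.2.1 - e'.2.1 ≤ (e.1 p - ν) * Real.exp (-(T * (e.1 p - e.2.2)))

def gelim (k : ℕ) (v v' : ℕ → ℤ) : ℕ → ℤ := fun i => v i * v' k - v' i * v k

theorem gdot_elim (k : ℕ) (v v' : ℕ → ℤ) (a : ℕ → ℝ) :
    gdot k (gelim k v v') a = gdot k v a * v' k - gdot k v' a * v k := by
  unfold gdot gelim
  rw [sum_mul, sum_mul, ← sum_sub_distrib]
  refine sum_congr rfl fun i _ => ?_
  push_cast; ring

theorem gdot_upd (k : ℕ) (v : ℕ → ℤ) (a : ℕ → ℝ) (x : ℝ) :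
    gdot (k+1) v (Function.update a k x) = gdot k v a + v k * x := by
  unfold gdot
  rw [sum_range_succ]
  congr 1
  · refine sum_congr rfl fun i hi => ?_
    rw [Function.update_of_ne (by have := mem_range.mp hi; omega)]
  · simp

theorem gac_exp_le {T a b : ℝ} (hT : 0 ≤ T) (h : b ≤ a) :
    Real.exp (-(T * a)) ≤ Real.exp (-(T * b)) := by
  apply Real.exp_le_exp.mpr
  nlinarith

theorem gac_exp_split {T a b d : ℝ} (hT : 0 ≤ T) (h : b + d ≤ a) :
    Real.exp (-(T * a)) * Real.exp (T * d) ≤ Real.exp (-(T * b)) := by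
  rw [← Real.exp_add]
  apply Real.exp_le_exp.mpr
  nlinarith

/-- combining children -/
theorem gac_node (m k : ℕ) (hk : 1 ≤ k) (H0 : Set (ℕ → ℤ)) (K d Ω : ℝ) (pre : ℕ → ℝ)
    (hd : 0 < d) (hb : 0 ≤ pre (k-1)) (ν dd : ℕ → ℝ) (N : ℕ) (hν0 : ν 0 = pre (k-1))
    (hν : Monotone ν) (hβ : ∀ i : ℕ, |pre (k-1) + i * d - ν i| ≤ dd i - 2 * d)
    (hdd : ∀ i j, ν i = ν j → dd i = dd j)
    (hfirst : ∀ l : ℕ, ν l < ν (l + 1) → 2 * d ≤ ((l : ℝ) + 1) * d)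
    (hN : Ω ≤ N * d)
    (hch : ∀ i, ∃ Λ ≥ 0, ∃ T0 : ℝ, ∀ T ≥ T0, ∃ L,
      GTail m (k+1) H0 K (dd i) Ω Λ T (Function.update pre k (ν i)) L) :
    ∃ Λ ≥ 0, ∃ T0 : ℝ, ∀ T ≥ T0, ∃ L, GTail m k H0 K d Ω Λ T pre L := by
  choose Λc hΛc T0c hLc using hch
  have hdd2 : ∀ i, 2 * d ≤ dd i := fun i => by
    have := (abs_nonneg _).trans (hβ i); linarith
  have hνb : ∀ i, pre (k-1) ≤ ν i := fun i => hν0 ▸ hν (Nat.zero_le i)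
  obtain ⟨γ, hγ, hgap⟩ := gac_gap ν N
  set Λ := ∑ i ∈ range (N+1), Λc i + ν N with hΛ
  have hΛle : ∀ i ≤ N, Λc i ≤ ∑ i ∈ range (N+1), Λc i := fun i hi =>
    single_le_sum (f := Λc) (fun j _ => hΛc j) (mem_range.mpr (by omega))
  have hνN : 0 ≤ ν N := hb.trans (hνb N)
  have hsum0 : 0 ≤ ∑ i ∈ range (N+1), Λc i := sum_nonneg fun j _ => hΛc j
  have hΛ0 : 0 ≤ Λ := by positivity
  obtain ⟨T1, hT1, hexp⟩ := gac_expLarge (1 + γ + Λ) γ d hγ hd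
  refine ⟨Λ, hΛ0, T1 + ∑ i ∈ range (N+1), |T0c i|, fun T hT => ?_⟩
  have habs0 : 0 ≤ ∑ i ∈ range (N+1), |T0c i| := sum_nonneg fun j _ => abs_nonneg _
  have hT0 : 0 ≤ T := by linarith
  have hTc : ∀ i ≤ N, T0c i ≤ T := fun i hi => by
    have := single_le_sum (f := fun i => |T0c i|) (s := range (N+1)) (fun j _ => abs_nonneg _)
      (mem_range.mpr (show i < N+1 by omega))
    have h2 := le_abs_self (T0c i)
    linarith
  have hLex : ∀ i, ∃ L, i ≤ N → GTail m (k+1) H0 K (dd i) Ω (Λc i) T (Function.update pre k (ν i)) L := by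
    intro i
    by_cases hi : i ≤ N
    · obtain ⟨L, hL⟩ := hLc i T (hTc i hi)
      exact ⟨L, fun _ => hL⟩
    · exact ⟨∅, fun h => absurd h hi⟩
  choose L hL using hLex
  set w : ℕ → ℝ := fun l => Real.exp (-(T * (pre (k-1) + (l+1 : ℕ) * d))) with hw
  set Cs : ℕ → ℝ := fun i => ∑ l ∈ range i, (ν (l+1) - ν l) * w l with hCs
  have hE := hexp T (by linarith)
  have hCs0 : ∀ i, 0 ≤ Cs i := fun i => sum_nonneg fun l _ =>
    mul_nonneg (sub_nonneg.mpr (hν (Nat.le_succ l))) (Real.exp_pos _).le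
  have hCs1 : ∀ i ≤ N, Cs i ≤ ν N * Real.exp (-(T * (pre (k-1) + 2 * d))) := by
    intro i hi
    have h1 : Cs i ≤ ∑ l ∈ range i, (ν (l+1) - ν l) * Real.exp (-(T * (pre (k-1) + 2 * d))) := by
      refine sum_le_sum fun l _ => ?_
      rcases (hν (Nat.le_succ l)).eq_or_lt with h | h
      · have h' : ν (l+1) = ν l := h.symm
        rw [h']; simp
      · refine mul_le_mul_of_nonneg_left ?_ (sub_nonneg.mpr h.le)
        refine gac_exp_le hT0 ?_
        have := hfirst l h
        push_cast; linarith
    rw [← sum_mul, sum_range_sub] at h1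
    refine h1.trans (mul_le_mul_of_nonneg_right ?_ (Real.exp_pos _).le)
    have := hν hi
    rw [hν0]; linarith
  -- last coordinate of child prefix
  have hlast : ∀ i, Function.update pre k (ν i) (k+1-1) = ν i := fun i => by simp
  have hC1c : ∀ i ≤ N, ∀ e ∈ L i, e.2.1 ≤ Λ * Real.exp (-(T * (ν i + 2 * dd i))) := by
    intro i hi e he
    have h1 := (hL i hi).C1 e he
    rw [hlast] at h1
    refine h1.trans (mul_le_mul_of_nonneg_right ?_ (Real.exp_pos _).le)
    have := hΛle i hi; linarith
  have hak : ∀ i ≤ N, ∀ e ∈ L i, e.1 k = ν i := by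
    intro i hi e he
    have := (hL i hi).pref e he k (by omega)
    simpa using this
  have hapre : ∀ i ≤ N, ∀ e ∈ L i, ∀ q < k, e.1 q = pre q := by
    intro i hi e he q hq
    have := (hL i hi).pref e he q (by omega)
    rwa [Function.update_of_ne (by omega)] at this
  have htie : ∀ i ≤ N, ∃ e ∈ L i, (∀ q < k, e.1 q = pre q) ∧ (∀ q, k ≤ q → q < m → e.1 q = ν i) ∧
      e.2.1 = 0 := by
    intro i hi
    obtain ⟨e, he, h1, h2, h3⟩ := (hL i hi).tie
    refine ⟨e, he, hapre i hi e he, fun q hq hqm => ?_, h3⟩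
    rcases hq.eq_or_lt with h | h
    · rw [← h]; exact hak i hi e he
    · rw [h2 q h hqm, hlast]
  refine ⟨{e | ∃ i ≤ N, ∃ e0 ∈ L i, e = (e0.1, Cs i + e0.2.1, e0.2.2)}, ?_⟩
  constructor
  · have : {e | ∃ i ≤ N, ∃ e0 ∈ L i, e = (e0.1, Cs i + e0.2.1, e0.2.2)} =
        ⋃ i ∈ Set.Iic N, (fun e0 : (ℕ → ℝ) × ℝ × ℝ => (e0.1, Cs i + e0.2.1, e0.2.2)) '' (L i) := by
      ext e
      simp only [Set.mem_ofPred_eq, Set.mem_iUnion, Set.mem_Iic, Set.mem_image, exists_prop]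
      constructor
      · rintro ⟨i, hi, e0, he0, rfl⟩; exact ⟨i, hi, e0, he0, rfl⟩
      · rintro ⟨i, hi, e0, he0, rfl⟩; exact ⟨i, hi, e0, he0, rfl⟩
    rw [this]
    exact (Set.finite_Iic N).biUnion fun i hi => ((hL i hi).fin.image _)
  · obtain ⟨e, he, h1, h2, h3⟩ := htie 0 (Nat.zero_le N)
    refine ⟨_, ⟨0, Nat.zero_le N, e, he, rfl⟩, h1, ?_, ?_⟩
    · intro q hq hqm; rw [← hν0]; exact h2 q hq hqm
    · simp [hCs, h3]
  · rintro _ ⟨i, hi, e, he, rfl⟩ q hq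
    exact hapre i hi e he q hq
  · rintro _ ⟨i, hi, e, he, rfl⟩ q hq hqm
    rcases hq.eq_or_lt with h | h
    · subst h
      show e.1 (k-1) ≤ e.1 k
      rw [hak i hi e he, hapre i hi e he (k-1) (by omega)]
      exact hνb i
    · exact (hL i hi).mon e he q h hqm
  · rintro _ ⟨i, hi, e, he, rfl⟩ q hq hqm
    rcases hq.eq_or_lt with h | h
    · subst h
      show e.1 k ≤ Λ
      rw [hak i hi e he]
      have := hν hi
      linarith
    · have h1 := (hL i hi).bdd e he q h hqm
      have := hΛle i hi
      show e.1 q ≤ Λ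
      linarith
  · rintro _ ⟨i, hi, e, he, rfl⟩
    exact add_nonneg (hCs0 i) ((hL i hi).C0 e he)
  · rintro _ ⟨i, hi, e, he, rfl⟩
    show Cs i + e.2.1 ≤ _
    have h1 := hCs1 i hi
    have h2 := (hL i hi).C1 e he
    rw [hlast] at h2
    have h3 : Real.exp (-(T * (ν i + 2 * dd i))) ≤ Real.exp (-(T * (pre (k-1) + 2 * d))) :=
      gac_exp_le hT0 (by have := hνb i; have := hdd2 i; linarith)
    have h4 : e.2.1 ≤ (∑ i ∈ range (N+1), Λc i) * Real.exp (-(T * (pre (k-1) + 2 * d))) :=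
      h2.trans (mul_le_mul (hΛle i hi) h3 (Real.exp_pos _).le hsum0)
    rw [hΛ, add_mul]; linarith
  · rintro _ ⟨i, hi, e, he, rfl⟩
    have := (hL i hi).dle e he
    have := hdd2 i
    show d ≤ e.2.2
    linarith
  · rintro _ ⟨i, hi, e, he, rfl⟩ v hv
    exact (hL i hi).coh e he v hv
  · rintro _ ⟨i, hi, e, he, rfl⟩ q hq hqm
    rcases hq.eq_or_lt with h | h
    · subst h
      show Ω ≤ e.1 k + e.2.2 ∨ _
      have hd' := (hL i hi).dle e he
      rcases gac_up ν w hν i N hi with ⟨h1, _⟩ | ⟨l, hil, hlN, h2, h3, h4⟩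
      · left
        rw [hak i hi e he, ← h1]
        have h5 := hβ N
        rw [abs_le] at h5
        rw [← hdd N i h1] at hd'
        linarith
      · right
        obtain ⟨e', he', g1, g2, g3⟩ := htie (l+1) hlN
        refine ⟨_, ⟨l+1, hlN, e', he', rfl⟩, ?_, ν (l+1), ?_, g2, ?_⟩
        · intro q hq
          show e'.1 q = e.1 q
          rw [g1 q hq, hapre i hi e he q hq]
        · have := hν hlN; linarith
        · show Cs i + e.2.1 + Real.exp (-(T * (e.1 k + e.2.2))) ≤ Cs (l+1) + e'.2.1
          rw [hak i hi e he, g3]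
          have h6 : Cs (l+1) = Cs i + (ν (l+1) - ν i) * w l := h4
          rw [h6]
          have hgl := hgap l hlN h3
          rw [h2] at hgl
          have h7 := hC1c i hi e he
          have h5 := hβ l
          rw [abs_le, h2, hdd l i h2] at h5
          have hkey : pre (k-1) + (l+1 : ℕ) * d + d ≤ ν i + dd i := by push_cast; linarith
          have h8 : Real.exp (-(T * (ν i + e.2.2))) * Real.exp (T * d) ≤ w l :=
            gac_exp_split hT0 (by linarith)
          have h9 : Real.exp (-(T * (ν i + 2 * dd i))) * Real.exp (T * d) ≤ w l :=
            gac_exp_split hT0 (by have := hdd2 i; linarith)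
          have hw0 : 0 < w l := Real.exp_pos _
          have hX : 0 < Real.exp (T * d) := Real.exp_pos _
          have h10 : e.2.1 * Real.exp (T * d) ≤ Λ * w l := by
            calc e.2.1 * Real.exp (T * d) ≤ (Λ * Real.exp (-(T * (ν i + 2 * dd i)))) * Real.exp (T * d) :=
                  mul_le_mul_of_nonneg_right h7 hX.le
              _ = Λ * (Real.exp (-(T * (ν i + 2 * dd i))) * Real.exp (T * d)) := by ring
              _ ≤ Λ * w l := mul_le_mul_of_nonneg_left h9 hΛ0
          have h11 : (e.2.1 + Real.exp (-(T * (ν i + e.2.2)))) * Real.exp (T * d) ≤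
              ((ν (l+1) - ν i) * w l) * Real.exp (T * d) := by
            have : (1 + Λ) * w l ≤ ((ν (l+1) - ν i) * Real.exp (T * d)) * w l := by
              refine mul_le_mul_of_nonneg_right ?_ hw0.le
              have := mul_le_mul_of_nonneg_right hgl hX.le
              linarith
            linarith
          have := le_of_mul_le_mul_right h11 hX
          linarith
    · rcases (hL i hi).S e he q h hqm with h1 | ⟨e', he', g1, ν', g2, g3, g4⟩
      · exact Or.inl h1
      · refine Or.inr ⟨_, ⟨i, hi, e', he', rfl⟩, g1, ν', ?_, g3, ?_⟩
        · have := hΛle i hi; linarith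
        · show Cs i + e.2.1 + Real.exp (-(T * (e.1 q + e.2.2))) ≤ Cs i + e'.2.1
          linarith
  · rintro _ ⟨i, hi, e, he, rfl⟩ q hq hqm
    rcases hq.eq_or_lt with h | h
    · subst h
      show e.1 k = e.1 (k-1) ∨ _
      have hd' := (hL i hi).dle e he
      rcases gac_down ν w hν i with h1 | ⟨l, hli, h2, h3, h4⟩
      · left
        rw [hak i hi e he, hapre i hi e he (k-1) (by omega), h1, hν0]
      · right
        obtain ⟨e', he', g1, g2, g3⟩ := htie l (by omega)
        refine ⟨_, ⟨l, by omega, e', he', rfl⟩, ?_, ν l, ?_, g2, ?_⟩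
        · intro q hq
          show e'.1 q = e.1 q
          rw [g1 q hq, hapre i hi e he q hq]
        · show ν l < e.1 k
          rw [hak i hi e he, ← h3]; exact h2
        · show Cs i + e.2.1 - (Cs l + e'.2.1) ≤ (e.1 k - ν l) * Real.exp (-(T * (e.1 k - e.2.2)))
          rw [hak i hi e he, g3]
          have h6 : Cs i = Cs l + (ν i - ν l) * w l := h4
          rw [h6]
          have hgl := hgap l (by omega) h2
          rw [h3] at hgl
          have h7 := hC1c i hi e he
          have h5 := hβ (l+1)
          rw [abs_le, h3, hdd (l+1) i h3] at h5
          have hX : 0 < Real.exp (T * d) := Real.exp_pos _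
          set Z := Real.exp (-(T * (ν i - e.2.2))) with hZ
          have hZ0 : 0 < Z := Real.exp_pos _
          have h8 : w l * Real.exp (T * d) ≤ Z := gac_exp_split hT0 (by linarith)
          have h9 : Real.exp (-(T * (ν i + 2 * dd i))) * Real.exp (T * d) ≤ Z :=
            gac_exp_split hT0 (by have := hdd2 i; linarith)
          have h10 : e.2.1 * Real.exp (T * d) ≤ Λ * Z := by
            calc e.2.1 * Real.exp (T * d) ≤ (Λ * Real.exp (-(T * (ν i + 2 * dd i)))) * Real.exp (T * d) :=
                  mul_le_mul_of_nonneg_right h7 hX.le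
              _ = Λ * (Real.exp (-(T * (ν i + 2 * dd i))) * Real.exp (T * d)) := by ring
              _ ≤ Λ * Z := mul_le_mul_of_nonneg_left h9 hΛ0
          have h12 : (ν i - ν l) * (w l * Real.exp (T * d)) ≤ (ν i - ν l) * Z :=
            mul_le_mul_of_nonneg_left h8 (by linarith)
          have hE1 : 1 ≤ Real.exp (T * d) := Real.one_le_exp (by positivity)
          have h13 : (ν i - ν l) + Λ ≤ (ν i - ν l) * Real.exp (T * d) := by nlinarith
          have h11 : ((ν i - ν l) * w l + e.2.1) * Real.exp (T * d) ≤
              ((ν i - ν l) * Z) * Real.exp (T * d) := by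
            have := mul_le_mul_of_nonneg_right h13 hZ0.le
            linarith
          have := le_of_mul_le_mul_right h11 hX
          linarith
    · rcases (hL i hi).S' e he q h hqm with h1 | ⟨e', he', g1, ν', g2, g3, g4⟩
      · exact Or.inl h1
      · refine Or.inr ⟨_, ⟨i, hi, e', he', rfl⟩, g1, ν', g2, g3, ?_⟩
        show Cs i + e.2.1 - (Cs i + e'.2.1) ≤ (e.1 q - ν') * Real.exp (-(T * (e.1 q - e.2.2)))
        linarith


theorem gac_bound (H : Set (ℕ → ℤ)) (hH : H.Finite) (k : ℕ) :
    ∃ c : ℝ, 1 ≤ c ∧ ∀ v ∈ H, |(v k : ℝ)| ≤ c := by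
  refine ⟨1 + ∑ v ∈ hH.toFinset, |(v k : ℝ)|, ?_, fun v hv => ?_⟩
  · have : 0 ≤ ∑ v ∈ hH.toFinset, |(v k : ℝ)| := sum_nonneg fun _ _ => abs_nonneg _
    linarith
  · have := single_le_sum (f := fun v : ℕ → ℤ => |(v k : ℝ)|) (s := hH.toFinset)
      (fun _ _ => abs_nonneg _) (hH.mem_toFinset.mpr hv)
    linarith

theorem gac_tail (H0 : Set (ℕ → ℤ)) (hH0 : H0.Finite) (K : ℝ) (hK : 1 ≤ K) (j : ℕ) :
    ∀ k, 1 ≤ k → ∃ Hk : Set (ℕ → ℤ), Hk.Finite ∧ ∃ K' : ℝ, 1 ≤ K' ∧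
      ∀ (pre : ℕ → ℝ) (d : ℝ), 0 < d → 0 ≤ pre (k-1) →
        (∀ v ∈ Hk, gdot k v pre = 0 ∨ K' * d ≤ |gdot k v pre|) → ∀ Ω : ℝ,
        ∃ Λ ≥ 0, ∃ T0 : ℝ, ∀ T ≥ T0, ∃ L, GTail (k+j) k H0 K d Ω Λ T pre L := by
  induction j with
  | zero =>
    intro k hk
    refine ⟨H0, hH0, K, hK, fun pre d hd hb hsep Ω => ⟨0, le_rfl, 0, fun T hT => ⟨{(pre, 0, d)}, ?_⟩⟩⟩
    constructor
    · exact Set.finite_singleton _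
    · exact ⟨_, rfl, fun _ _ => rfl, fun q h1 h2 => by omega, rfl⟩
    · rintro _ rfl i _; rfl
    · intro e he i h1 h2; omega
    · intro e he i h1 h2; omega
    · rintro _ rfl; exact le_rfl
    · rintro _ rfl; simp
    · rintro _ rfl; exact le_rfl
    · rintro _ rfl v hv; exact hsep v hv
    · intro e he i h1 h2; omega
    · intro e he i h1 h2; omega
  | succ j ih =>
    intro k hk
    obtain ⟨H1, hH1, K1, hK1, hT⟩ := ih (k+1) (by omega)
    set tie : ℕ → ℤ := fun i => if i = k - 1 then 1 else if i = k then -1 else 0 with htie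
    have htk : tie k = -1 := by
      show (if k = k - 1 then (1:ℤ) else if k = k then -1 else 0) = -1
      rw [if_neg (by omega), if_pos rfl]
    have htdot : ∀ pre : ℕ → ℝ, gdot k tie pre = pre (k-1) := by
      intro pre
      unfold gdot
      rw [sum_eq_single (k-1)]
      · simp [htie]
      · intro b hb hbk
        have := mem_range.mp hb
        simp only [htie]; rw [if_neg hbk, if_neg (by omega)]; simp
      · intro h; exact absurd (mem_range.mpr (by omega)) h
    set H' := insert tie H1 with hH'
    have hH'f : H'.Finite := hH1.insert _
    obtain ⟨c, hc, hcb⟩ := gac_bound H' hH'f k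
    have hc2 : 1 ≤ c^2 := one_le_pow₀ hc
    have hK2 : K1 ≤ K1^2 := by nlinarith
    refine ⟨Set.image2 (gelim k) H' H', hH'f.image2 _ hH'f, 6 * c^2 * K1^2, by nlinarith,
      fun pre d hd hb hsep Ω => ?_⟩
    set b0 := pre (k-1) with hb0
    set ε := 2 * K1 * d with hε
    have hK1d : K1^2 * d ≤ c^2 * (K1^2 * d) := by
      have : 0 ≤ K1^2 * d := by positivity
      nlinarith
    have hintge : ∀ z : ℤ, z ≠ 0 → (1:ℝ) ≤ |(z:ℝ)| := fun z hz => by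
      have := Int.one_le_abs hz
      exact_mod_cast this
    -- key separation
    have hsep2 : ∀ v ∈ H', ∀ v' ∈ H', gdot k v pre * v' k - gdot k v' pre * v k = 0 ∨
        6 * c^2 * (K1^2 * d) ≤ |gdot k v pre * v' k - gdot k v' pre * v k| := by
      intro v hv v' hv'
      have := hsep _ (Set.mem_image2_of_mem hv hv')
      rw [gdot_elim] at this
      rcases this with h | h
      · exact Or.inl h
      · right; linarith
    set Res : Set ℝ := {x | ∃ v ∈ H', v k ≠ 0 ∧ (v k : ℝ) * x = -gdot k v pre} with hRes
    have hbRes : b0 ∈ Res := by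
      refine ⟨tie, Set.mem_insert _ _, by rw [htk]; decide, ?_⟩
      rw [htk, htdot]; push_cast; ring
    have hsepRes : ∀ x ∈ Res, ∀ x' ∈ Res, x = x' ∨ 2 * ε < |x - x'| := by
      rintro x ⟨v, hv, hvk, hx⟩ x' ⟨v', hv', hvk', hx'⟩
      have hvk2 : (v k : ℝ) ≠ 0 := by exact_mod_cast hvk
      have hvk2' : (v' k : ℝ) ≠ 0 := by exact_mod_cast hvk'
      have e : (v k : ℝ) * v' k * (x - x') = -(gdot k v pre * v' k - gdot k v' pre * v k) := by
        linear_combination (v' k : ℝ) * hx - (v k : ℝ) * hx'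
      rcases hsep2 v hv v' hv' with h | h
      · left
        rw [h, neg_zero] at e
        rcases mul_eq_zero.mp e with h1 | h1
        · exact absurd h1 (mul_ne_zero hvk2 hvk2')
        · linarith
      · right
        rw [← abs_neg, ← e, abs_mul, abs_mul] at h
        have h1 : |(v k : ℝ)| * |(v' k : ℝ)| ≤ c^2 := by
          rw [sq]; exact mul_le_mul (hcb v hv) (hcb v' hv') (abs_nonneg _) (by linarith)
        have h2 : 6 * c^2 * (K1^2 * d) ≤ c^2 * |x - x'| :=
          h.trans (mul_le_mul_of_nonneg_right h1 (abs_nonneg _))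
        have h3 : 6 * (K1^2 * d) ≤ |x - x'| := by
          refine le_of_mul_le_mul_left ?_ (show 0 < c^2 by positivity)
          linarith
        have h4 : K1 * d ≤ K1^2 * d := mul_le_mul_of_nonneg_right hK2 hd.le
        have h5 : 0 < K1 * d := by positivity
        rw [hε]; nlinarith
    obtain ⟨ν, dd, hν0, hνm, hβ, hdd, hfirst⟩ := gac_slopes Res b0 d ε hd
      (by rw [hε]; nlinarith) hbRes hsepRes
    obtain ⟨N, hN⟩ := exists_nat_ge (Ω / d)
    have hε2 : 2 * d ≤ ε := by rw [hε]; nlinarith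
    have hddpos : ∀ i, 2 * d ≤ dd i := fun i => by
      have := (abs_nonneg _).trans (hβ i); linarith
    have hddeq : ∀ i j, ν i = ν j → dd i = dd j := by
      intro i j hij
      have hε0 : 0 < ε := by linarith
      rcases hdd i with ⟨h1, h2⟩ | ⟨h1, h2⟩ <;> rcases hdd j with ⟨h1', h2'⟩ | ⟨h1', h2'⟩
      · rw [h2, h2']
      · have := h2' _ h1
        rw [hij, sub_self, abs_zero] at this; linarith
      · have := h2 _ h1'
        rw [hij, sub_self, abs_zero] at this; linarith
      · rw [h1, h1']
    have hres := gac_node (k + (j+1)) k hk H0 K d Ω pre hd hb ν dd N hν0 hνm hβ hddeq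
      (fun l hl => hε2.trans (hfirst l hl)) ((div_le_iff₀ hd).mp hN) (fun i => ?_)
    · exact hres
    have e : k + (j+1) = k + 1 + j := by ring
    rw [e]
    refine hT _ (dd i) (by have := hddpos i; linarith) ?_ ?_ Ω
    · simp
      have := hνm (Nat.zero_le i); rw [hν0] at this; exact hb.trans this
    · intro v hv
      have hvH : v ∈ H' := Set.mem_insert_of_mem _ hv
      rw [gdot_upd]
      have hddle : K1 * dd i ≤ 6 * (K1^2 * d) := by
        rcases hdd i with ⟨_, h2⟩ | ⟨h2, _⟩
        · rw [h2, hε]; apply le_of_eq; ring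
        · rw [h2]; nlinarith
      by_cases hvk : v k = 0
      · have h1 := hsep2 v hvH tie (Set.mem_insert _ _)
        rw [htk] at h1
        rw [hvk] at h1 ⊢
        push_cast at h1 ⊢
        have e1 : gdot k v pre * (-1) - gdot k tie pre * 0 = -gdot k v pre := by ring
        rw [e1, abs_neg] at h1
        rw [zero_mul, add_zero]
        rcases h1 with h1 | h1
        · left; linarith
        · right; linarith
      · rcases hdd i with ⟨⟨v', hv', hvk', hx⟩, h2⟩ | ⟨h2, h3⟩
        · have hvk2' : (v' k : ℝ) ≠ 0 := by exact_mod_cast hvk'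
          have e1 : (v' k : ℝ) * (gdot k v pre + v k * ν i) =
              gdot k v pre * v' k - gdot k v' pre * v k := by
            linear_combination (v k : ℝ) * hx
          rcases hsep2 v hvH v' hv' with h | h
          · left
            rw [h] at e1
            exact (mul_eq_zero.mp e1).resolve_left hvk2'
          · right
            rw [← e1, abs_mul] at h
            have h4 := mul_le_mul_of_nonneg_right (hcb v' hv') (abs_nonneg (gdot k v pre + v k * ν i))
            have h5 : c * (6 * (c * (K1^2 * d))) ≤ c * |gdot k v pre + v k * ν i| := by linarith
            have h6 := le_of_mul_le_mul_left h5 (by linarith : (0:ℝ) < c)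
            have h7 : K1^2 * d ≤ c * (K1^2 * d) := by
              have : 0 ≤ K1^2 * d := by positivity
              nlinarith
            linarith
        · right
          have hvk2 : (v k : ℝ) ≠ 0 := by exact_mod_cast hvk
          have hr : -gdot k v pre / v k ∈ Res := ⟨v, hvH, hvk, by field_simp⟩
          have h4 := h3 _ hr
          have e1 : gdot k v pre + v k * ν i = v k * (ν i - -gdot k v pre / v k) := by
            field_simp; ring
          rw [e1, abs_mul, h2]
          have h5 := hintge _ hvk
          have h6 := mul_le_mul_of_nonneg_right h5 (abs_nonneg (ν i - -gdot k v pre / v k))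
          rw [hε] at h4
          linarith


structure GFam {n r : ℕ} (y : Fin r → Fin n → ℕ) (k : ℕ) (K d0 Ω Λ T : ℝ)
    (L : Set ((ℕ → ℝ) × ℝ × ℝ)) : Prop where
  fin : L.Finite
  ones : ∃ e ∈ L, (∀ i < k, e.1 i = 0) ∧ (∀ q, k ≤ q → q < n → e.1 q = 1) ∧ e.2.1 = Real.exp (-T)
  zero : ∀ e ∈ L, ∀ i < k, e.1 i = 0
  one : ∀ e ∈ L, e.1 k = 1
  mon : ∀ e ∈ L, ∀ i j, i ≤ j → j < n → e.1 i ≤ e.1 j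
  nonneg : ∀ e ∈ L, ∀ i < n, 0 ≤ e.1 i
  bdd : ∀ e ∈ L, ∀ i < n, e.1 i ≤ Λ
  C0 : ∀ e ∈ L, Real.exp (-T) ≤ e.2.1
  C1 : ∀ e ∈ L, e.2.1 ≤ 2 * Real.exp (-T)
  dle : ∀ e ∈ L, d0 ≤ e.2.2
  coh : ∀ e ∈ L, ∀ (σ : Equiv.Perm (Fin n)) (i j : Fin r),
    ∑ q : Fin n, e.1 q * (y j (σ q) : ℝ) < ∑ q : Fin n, e.1 q * (y i (σ q) : ℝ) →
    ∑ q : Fin n, e.1 q * (y j (σ q) : ℝ) + K * e.2.2 ≤ ∑ q : Fin n, e.1 q * (y i (σ q) : ℝ)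
  coh2 : ∀ e ∈ L, ∀ p < n, ∀ q < n, e.1 p < e.1 q → e.1 p + K * e.2.2 ≤ e.1 q
  S : ∀ e ∈ L, ∀ p, k < p → p < n → Ω ≤ e.1 p + e.2.2 ∨
    ∃ e' ∈ L, (∀ i < p, e'.1 i = e.1 i) ∧ ∃ ν ≤ Λ, (∀ q, p ≤ q → q < n → e'.1 q = ν) ∧
      e.2.1 + Real.exp (-(T * (e.1 p + e.2.2))) ≤ e'.2.1
  S' : ∀ e ∈ L, ∀ p, k < p → p < n → e.1 p = e.1 (p-1) ∨
    ∃ e' ∈ L, (∀ i < p, e'.1 i = e.1 i) ∧ ∃ ν < e.1 p, (∀ q, p ≤ q → q < n → e'.1 q = ν) ∧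
      e.2.1 - e'.2.1 ≤ (e.1 p - ν) * Real.exp (-(T * (e.1 p - e.2.2)))

def gform1 {n r : ℕ} (y : Fin r → Fin n → ℕ) (x : Equiv.Perm (Fin n) × Fin r × Fin r) : ℕ → ℤ :=
  fun q => if h : q < n then (y x.2.1 (x.1 ⟨q, h⟩) : ℤ) - y x.2.2 (x.1 ⟨q, h⟩) else 0

def gform2 {n : ℕ} (x : Fin n × Fin n) : ℕ → ℤ :=
  fun q => (if q = x.1 then 1 else 0) - (if q = x.2 then 1 else 0)

theorem gdot_form1 {n r : ℕ} (y : Fin r → Fin n → ℕ) (x : Equiv.Perm (Fin n) × Fin r × Fin r)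
    (a : ℕ → ℝ) : gdot n (gform1 y x) a =
      ∑ q : Fin n, a q * (y x.2.1 (x.1 q) : ℝ) - ∑ q : Fin n, a q * (y x.2.2 (x.1 q) : ℝ) := by
  unfold gdot gform1
  rw [Finset.sum_range, ← sum_sub_distrib]
  refine sum_congr rfl fun q _ => ?_
  rw [dif_pos q.2]
  push_cast; ring

theorem gdot_form2 {n : ℕ} (x : Fin n × Fin n) (a : ℕ → ℝ) :
    gdot n (gform2 x) a = a x.1 - a x.2 := by
  unfold gdot gform2
  push_cast
  simp only [sub_mul, sum_sub_distrib, ite_mul, one_mul, zero_mul]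
  rw [sum_ite_eq_of_mem' _ _ _ (mem_range.mpr x.1.2), sum_ite_eq_of_mem' _ _ _ (mem_range.mpr x.2.2)]

theorem gac_fam {n r : ℕ} (y : Fin r → Fin n → ℕ) (K : ℝ) (hK : 1 ≤ K) (k : ℕ) (hk : k < n) :
    ∃ d0 : ℝ, 0 < d0 ∧ ∀ Ω : ℝ, ∃ Λ : ℝ, ∃ T0 : ℝ, ∀ T ≥ T0, ∃ L,
      GFam y k K d0 Ω Λ T L := by
  obtain ⟨Hk, hHk, K', hK', hT⟩ := gac_tail (Set.range (gform1 y) ∪ Set.range (gform2 (n := n)))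
    ((Set.finite_range _).union (Set.finite_range _)) K hK (n - (k+1)) (k+1) (by omega)
  have hnk : k + 1 + (n - (k+1)) = n := by omega
  rw [hnk] at hT
  have hK0 : 0 < K' := by linarith
  refine ⟨1 / K', by positivity, fun Ω => ?_⟩
  set pre : ℕ → ℝ := fun i => if i = k then 1 else 0 with hpre
  have hpk : pre (k + 1 - 1) = 1 := by simp [hpre]
  have hp0 : ∀ i < k, pre i = 0 := fun i hi => by
    simp only [hpre]; rw [if_neg (by omega)]
  have hpk' : pre k = 1 := by simp [hpre]
  obtain ⟨Λ, hΛ, T0, hL⟩ := hT pre (1 / K') (by positivity) (by rw [hpk]; exact zero_le_one)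
    (fun v hv => by
      have : gdot (k+1) v pre = v k := by
        unfold gdot
        rw [sum_range_succ, hpk', sum_eq_zero, zero_add, mul_one]
        intro i hi
        rw [hp0 i (mem_range.mp hi), mul_zero]
      rw [this]
      by_cases h : v k = 0
      · left; rw [h]; simp
      · right
        rw [mul_one_div_cancel hK0.ne']
        exact_mod_cast Int.one_le_abs h) Ω
  obtain ⟨T1, hT1, hexp⟩ := gac_expLarge Λ 1 (2 * (1/K')) one_pos (by positivity)
  refine ⟨Λ + 1, max T0 T1, fun T hT => ?_⟩
  obtain ⟨L, h⟩ := hL T ((le_max_left _ _).trans hT)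
  have hE := hexp T ((le_max_right _ _).trans hT)
  have hbase : ∀ e ∈ L, e.1 k = 1 := fun e he => by
    rw [h.pref e he k (by omega), hpk']
  have hzero : ∀ e ∈ L, ∀ i < k, e.1 i = 0 := fun e he i hi => by
    rw [h.pref e he i (by omega), hp0 i hi]
  have hstep : ∀ e ∈ L, ∀ i, i + 1 < n → e.1 i ≤ e.1 (i+1) := by
    intro e he i hi
    rcases lt_trichotomy (i+1) k with h1 | h1 | h1
    · rw [hzero e he i (by omega), hzero e he _ h1]
    · rw [h1, hbase e he, hzero e he i (by omega)]; exact zero_le_one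
    · exact h.mon e he (i+1) (by omega) hi
  have hmon : ∀ e ∈ L, ∀ i j, i ≤ j → j < n → e.1 i ≤ e.1 j := by
    intro e he i j hij
    induction j, hij using Nat.le_induction with
    | base => intro _; exact le_rfl
    | succ j hj ih => intro hj2; exact (ih (by omega)).trans (hstep e he j hj2)
  have hnn : ∀ e ∈ L, ∀ i < n, 0 ≤ e.1 i := by
    intro e he i hi
    rcases lt_or_ge i k with h1 | h1
    · rw [hzero e he i h1]
    · have := hmon e he k i h1 hi
      rw [hbase e he] at this; linarith
  have hcoh1 : ∀ e ∈ L, ∀ p < n, ∀ q < n, e.1 p < e.1 q → e.1 p + K * e.2.2 ≤ e.1 q := by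
    intro e he p hp q hq hpq
    have := h.coh e he (gform2 (⟨q, hq⟩, ⟨p, hp⟩)) (Or.inr ⟨_, rfl⟩)
    rw [gdot_form2] at this
    simp only at this
    rcases this with h1 | h1
    · linarith
    · rw [abs_of_pos (by linarith)] at h1; linarith
  have hcoh : ∀ e ∈ L, ∀ (σ : Equiv.Perm (Fin n)) (i j : Fin r),
      ∑ q : Fin n, e.1 q * (y j (σ q) : ℝ) < ∑ q : Fin n, e.1 q * (y i (σ q) : ℝ) →
      ∑ q : Fin n, e.1 q * (y j (σ q) : ℝ) + K * e.2.2 ≤ ∑ q : Fin n, e.1 q * (y i (σ q) : ℝ) := by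
    intro e he σ i j hlt
    have := h.coh e he (gform1 y (σ, i, j)) (Or.inl ⟨_, rfl⟩)
    rw [gdot_form1] at this
    simp only at this
    rcases this with h1 | h1
    · linarith
    · rw [abs_of_pos (by linarith)] at h1; linarith
  have hmem : ∀ e ∈ L, (e.1, Real.exp (-T) + e.2.1, e.2.2) ∈
      (fun e : (ℕ → ℝ) × ℝ × ℝ => (e.1, Real.exp (-T) + e.2.1, e.2.2)) '' L := fun e he => ⟨e, he, rfl⟩
  refine ⟨(fun e => (e.1, Real.exp (-T) + e.2.1, e.2.2)) '' L, ?_⟩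
  constructor
  · exact h.fin.image _
  · obtain ⟨e, he, h1, h2, h3⟩ := h.tie
    refine ⟨_, hmem e he, hzero e he, ?_, by simp [h3]⟩
    intro q hq hqn
    rcases hq.eq_or_lt with h4 | h4
    · rw [← h4]; exact hbase e he
    · have := h2 q h4 hqn
      rw [hpk] at this; exact this
  · rintro _ ⟨e, he, rfl⟩; exact hzero e he
  · rintro _ ⟨e, he, rfl⟩; exact hbase e he
  · rintro _ ⟨e, he, rfl⟩; exact hmon e he
  · rintro _ ⟨e, he, rfl⟩; exact hnn e he
  · rintro _ ⟨e, he, rfl⟩ i hi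
    show e.1 i ≤ Λ + 1
    rcases lt_trichotomy i k with h1 | h1 | h1
    · rw [hzero e he i h1]; linarith
    · rw [h1, hbase e he]; linarith
    · have := h.bdd e he i h1 hi; linarith
  · rintro _ ⟨e, he, rfl⟩
    have := h.C0 e he
    show Real.exp (-T) ≤ Real.exp (-T) + e.2.1
    linarith
  · rintro _ ⟨e, he, rfl⟩
    have h1 := h.C1 e he
    show Real.exp (-T) + e.2.1 ≤ 2 * Real.exp (-T)
    rw [hpk] at h1
    have e1 : Real.exp (-(T * (1 + 2 * (1/K')))) * Real.exp (T * (2 * (1/K'))) = Real.exp (-T) := by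
      rw [← Real.exp_add]; ring_nf
    have h2 := mul_le_mul_of_nonneg_left hE (Real.exp_pos (-(T * (1 + 2 * (1/K'))))).le
    rw [one_mul, e1] at h2
    linarith
  · rintro _ ⟨e, he, rfl⟩; exact h.dle e he
  · rintro _ ⟨e, he, rfl⟩; exact hcoh e he
  · rintro _ ⟨e, he, rfl⟩; exact hcoh1 e he
  · rintro _ ⟨e, he, rfl⟩ p hp hpn
    rcases h.S e he p hp hpn with h1 | ⟨e', he', g1, ν', g2, g3, g4⟩
    · exact Or.inl h1
    · refine Or.inr ⟨_, hmem e' he', g1, ν', by linarith, g3, ?_⟩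
      show Real.exp (-T) + e.2.1 + Real.exp (-(T * (e.1 p + e.2.2))) ≤ Real.exp (-T) + e'.2.1
      linarith
  · rintro _ ⟨e, he, rfl⟩ p hp hpn
    rcases h.S' e he p hp hpn with h1 | ⟨e', he', g1, ν', g2, g3, g4⟩
    · exact Or.inl h1
    · refine Or.inr ⟨_, hmem e' he', g1, ν', g2, g3, ?_⟩
      show Real.exp (-T) + e.2.1 - (Real.exp (-T) + e'.2.1) ≤
        (e.1 p - ν') * Real.exp (-(T * (e.1 p - e.2.2)))
      linarith


theorem gac_sort {n : ℕ} (X : Fin n → ℝ) : ∃ σ : Equiv.Perm (Fin n), Antitone (X ∘ σ) := by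
  refine ⟨Tuple.sort (fun j => -X j), fun i j hij => ?_⟩
  have := Tuple.monotone_sort (fun j => -X j) hij
  simp only [Function.comp] at this ⊢
  linarith

theorem gac_rearr {n : ℕ} (X a : Fin n → ℝ) (ha : Monotone a) (σ σ' : Equiv.Perm (Fin n))
    (h : Antitone (X ∘ σ)) : ∑ q, a q * X (σ q) ≤ ∑ q, a q * X (σ' q) := by
  have h1 : Antivary a (X ∘ σ) := ha.antivary h
  have h2 := h1.sum_mul_le_sum_mul_comp_perm (σ := σ'.trans σ.symm)
  simpa using h2

theorem gac_blocksort {n : ℕ} (a z : Fin n → ℝ) (ha : Monotone a) :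
    ∃ π : Equiv.Perm (Fin n), (∀ q, a (π q) = a q) ∧
      ∀ p q, p ≤ q → a p = a q → z (π q) ≤ z (π p) := by
  set g : Fin n → ℝ ×ₗ ℝ := fun q => toLex (a q, - z q) with hg
  have hm := Tuple.monotone_sort g
  set π := Tuple.sort g with hπ
  have hle : ∀ p q, p ≤ q → a (π p) < a (π q) ∨ a (π p) = a (π q) ∧ - z (π p) ≤ - z (π q) := by
    intro p q hpq
    have := hm hpq
    simp only [hg, Function.comp] at this
    rw [Prod.Lex.toLex_le_toLex] at this
    exact this
  have hmon : Monotone (a ∘ π) := by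
    intro p q hpq
    rcases hle p q hpq with h | h
    · exact h.le
    · exact h.1.le
  have heq : a ∘ π = a ∘ (1 : Equiv.Perm (Fin n)) := Tuple.unique_monotone hmon (by simpa using ha)
  have heq' : ∀ q, a (π q) = a q := fun q => by
    have := congrFun heq q
    simpa using this
  refine ⟨π, heq', fun p q hpq hapq => ?_⟩
  rcases hle p q hpq with h | h
  · rw [heq', heq'] at h; linarith
  · linarith [h.2]

theorem gac_cell {n r : ℕ} {y : Fin r → Fin n → ℕ} {k : ℕ} {K d0 Ω Λ T : ℝ}
    {L : Set ((ℕ → ℝ) × ℝ × ℝ)} (F : GFam y k K d0 Ω Λ T L)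
    (x : Fin n → ℝ) (hx : ∀ q, 0 ≤ x q) (hanti : Antitone x) (e : (ℕ → ℝ) × ℝ × ℝ) (he : e ∈ L)
    (hneg : ∑ q : Fin n, e.1 q * x q < e.2.1)
    (hmin : ∀ e' ∈ L, ∑ q : Fin n, e.1 q * x q - e.2.1 ≤ ∑ q : Fin n, e'.1 q * x q - e'.2.1)
    (hT0 : 0 ≤ T) (hT : 2 ≤ Real.exp (T * d0)) (q : ℕ) (hkq : k ≤ q) :
    ∀ hq : q < n, x ⟨q, hq⟩ ≤ Real.exp (-(T * (e.1 q - e.2.2))) := by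
  induction q, hkq using Nat.le_induction with
  | base =>
    intro hq
    rw [F.one e he]
    have h1 : e.1 k * x ⟨k, hq⟩ ≤ ∑ q : Fin n, e.1 q * x q :=
      single_le_sum (f := fun q : Fin n => e.1 q * x q)
        (fun i _ => mul_nonneg (F.nonneg e he i i.2) (hx i)) (mem_univ ⟨k, hq⟩)
    rw [F.one e he, one_mul] at h1
    have h2 := F.C1 e he
    have h3 : Real.exp (-T) * Real.exp (T * d0) ≤ Real.exp (-(T * (1 - e.2.2))) := by
      rw [← Real.exp_add]
      apply Real.exp_le_exp.mpr
      have := F.dle e he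
      nlinarith
    have h4 := mul_le_mul_of_nonneg_left hT (Real.exp_pos (-T)).le
    linarith
  | succ q hkq ih =>
    intro hq
    rcases F.S' e he (q+1) (by omega) hq with h1 | ⟨e', he', g1, ν, g2, g3, g4⟩
    · rw [h1, Nat.add_sub_cancel]
      exact (hanti (show (⟨q, by omega⟩ : Fin n) ≤ ⟨q+1, hq⟩ by simp)).trans (ih (by omega))
    · have h5 := hmin e' he'
      have h6 : (e.1 (q+1) - ν) * x ⟨q+1, hq⟩ ≤ ∑ i : Fin n, (e.1 i - e'.1 i) * x i := by
        have hnn : ∀ i ∈ (univ : Finset (Fin n)), 0 ≤ (e.1 i - e'.1 i) * x i := by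
          intro i _
          refine mul_nonneg ?_ (hx i)
          rcases lt_or_ge (i : ℕ) (q+1) with h | h
          · rw [g1 i h, sub_self]
          · rw [g3 i h i.2]
            have := F.mon e he (q+1) i h i.2
            linarith
        have h := single_le_sum hnn (mem_univ ⟨q+1, hq⟩)
        simp only at h
        rwa [g3 (q+1) le_rfl hq] at h
      have h7 : ∑ i : Fin n, (e.1 i - e'.1 i) * x i =
          ∑ q : Fin n, e.1 q * x q - ∑ q : Fin n, e'.1 q * x q := by
        rw [← sum_sub_distrib]; exact sum_congr rfl fun i _ => by ring
      have h8 : (e.1 (q+1) - ν) * x ⟨q+1, hq⟩ ≤ (e.1 (q+1) - ν) *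
          Real.exp (-(T * (e.1 (q+1) - e.2.2))) := by linarith
      exact le_of_mul_le_mul_left h8 (by linarith)

theorem gac_slack {n r : ℕ} {y : Fin r → Fin n → ℕ} {k : ℕ} {K d0 Ω Λ T lam : ℝ}
    {L : Set ((ℕ → ℝ) × ℝ × ℝ)} (F : GFam y k K d0 Ω Λ T L) (hk : k < n)
    (z : Fin n → ℝ) (hz0 : ∀ q, 0 ≤ z q) (e : (ℕ → ℝ) × ℝ × ℝ) (he : e ∈ L)
    (hB : ∀ π : Equiv.Perm (Fin n), ∀ e' ∈ L, e'.2.1 ≤ ∑ q : Fin n, e'.1 q * z (π q))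
    (hz : ∀ q : Fin n, k ≤ q → z q ≤ Real.exp lam * Real.exp (-(T * (e.1 q - e.2.2))))
    (hlow : ∀ q, Real.exp (-(T * Ω)) ≤ z q) (hK : 3 ≤ K) (hd0 : 0 < d0) (hT0 : 0 ≤ T)
    (hlam : 0 ≤ lam) (hlT : 4 * lam ≤ T * d0)
    (hnL : n * Λ ≤ Real.exp lam) (h2 : 2 ≤ Real.exp lam) (hn : (n : ℝ) ≤ Real.exp lam) :
    ∃ s ≥ 0, e.2.1 + s ≤ ∑ q : Fin n, e.1 q * z q ∧
      ∀ q : Fin n, k ≤ q → Real.exp (-(T * (e.1 q + 2 * e.2.2))) ≤ z q ∨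
        1 / 2 * Real.exp (-(T * (e.1 q + e.2.2))) ≤ s := by
  have hd := F.dle e he
  have hkpos : ∀ q : Fin n, 0 < e.1 q → k ≤ q := by
    intro q hq
    by_contra h
    rw [F.zero e he q (by omega)] at hq
    exact lt_irrefl _ hq
  have hposk : ∀ q : Fin n, k ≤ q → 0 < e.1 q := by
    intro q hq
    have := F.mon e he k q hq q.2
    rw [F.one e he] at this
    linarith
  by_cases hv : ∃ q : Fin n, k ≤ q ∧ z q < Real.exp (-(T * (e.1 q + 2 * e.2.2)))
  swap
  · push Not at hv
    refine ⟨0, le_rfl, ?_, fun q hq => Or.inl (hv q hq)⟩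
    rw [add_zero]
    exact hB 1 e he
  obtain ⟨q0, hq0, hq0z⟩ := hv
  obtain ⟨π, hπa, hπz⟩ := gac_blocksort (fun q : Fin n => e.1 q) z
    (fun i j hij => F.mon e he i j hij j.2)
  classical
  set P : Finset (Fin n) := univ.filter
    (fun q => k ≤ q ∧ z (π q) < Real.exp (-(T * (e.1 q + 2 * e.2.2)))) with hP
  have hPmem : ∀ q0 : Fin n, k ≤ q0 → z q0 < Real.exp (-(T * (e.1 q0 + 2 * e.2.2))) →
      π.symm q0 ∈ P ∧ e.1 (π.symm q0) = e.1 q0 := by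
    intro q0 hq0 hq0z
    have e1 : e.1 (π.symm q0) = e.1 q0 := by
      have := hπa (π.symm q0)
      rw [Equiv.apply_symm_apply] at this
      exact this.symm
    refine ⟨?_, e1⟩
    rw [hP, mem_filter]
    refine ⟨mem_univ _, hkpos _ ?_, ?_⟩
    · rw [e1]; exact hposk q0 hq0
    · rw [e1, Equiv.apply_symm_apply]; exact hq0z
  obtain ⟨p, hpP, hpmin⟩ := P.exists_min_image id ⟨_, (hPmem q0 hq0 hq0z).1⟩
  simp only [id] at hpmin
  rw [hP, mem_filter] at hpP
  obtain ⟨-, hkp, hpz⟩ := hpP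
  have hTd : T * d0 ≤ T * e.2.2 := mul_le_mul_of_nonneg_left hd hT0
  have hd00 : 0 < e.2.2 := by linarith
  have hsmall : ∀ q : Fin n, p ≤ q → z (π q) ≤ Real.exp lam * Real.exp (-(T * (e.1 p + 2 * e.2.2))) := by
    intro q hq
    rcases (F.mon e he p q hq q.2).eq_or_lt with h | h
    · have h3 := hπz p q hq h
      have h4 : Real.exp (-(T * (e.1 p + 2 * e.2.2))) ≤
          Real.exp lam * Real.exp (-(T * (e.1 p + 2 * e.2.2))) :=
        le_mul_of_one_le_left (Real.exp_pos _).le (by linarith)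
      linarith
    · have h3 := F.coh2 e he p p.2 q q.2 h
      have h4 := hz (π q) (hkpos _ (by
        have := hposk q (hkp.trans hq)
        rw [hπa]; exact this))
      rw [hπa] at h4
      refine h4.trans (mul_le_mul_of_nonneg_left (gac_exp_le hT0 ?_) (Real.exp_pos _).le)
      nlinarith
  -- key smallness
  have hkey : Real.exp lam * (Real.exp lam * Real.exp (-(T * (e.1 p + 2 * e.2.2)))) ≤
      1 / 2 * Real.exp (-(T * (e.1 p + e.2.2))) := by
    have h3 : Real.exp lam * (Real.exp lam * Real.exp (-(T * (e.1 p + 2 * e.2.2)))) * Real.exp lam ≤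
        Real.exp (-(T * (e.1 p + e.2.2))) := by
      rw [← Real.exp_add, ← Real.exp_add, ← Real.exp_add]
      apply Real.exp_le_exp.mpr
      nlinarith
    have h4 : 0 ≤ Real.exp lam * (Real.exp lam * Real.exp (-(T * (e.1 p + 2 * e.2.2)))) := by positivity
    nlinarith
  rcases hkp.eq_or_lt with hpk | hpk
  · exfalso
    obtain ⟨e1, he1, g1, g2, g3⟩ := F.ones
    have h3 := hB π e1 he1
    have h4 : ∀ q ∈ (univ : Finset (Fin n)), e1.1 q * z (π q) ≤
        Real.exp lam * Real.exp (-(T * (e.1 p + 2 * e.2.2))) := by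
      intro q _
      rcases lt_or_ge (q : ℕ) k with h | h
      · rw [g1 q h, zero_mul]; positivity
      · rw [g2 q h q.2, one_mul]
        exact hsmall q (by rw [Fin.le_def, ← hpk]; exact h)
    have h5 := sum_le_card_nsmul _ _ _ h4
    rw [card_univ, Fintype.card_fin, nsmul_eq_mul] at h5
    have h6 := mul_le_mul_of_nonneg_right hn
      (show 0 ≤ Real.exp lam * Real.exp (-(T * (e.1 p + 2 * e.2.2))) by positivity)
    have h7 : Real.exp (-(T * (e.1 p + e.2.2))) ≤ Real.exp (-T) := by
      rw [← hpk, F.one e he]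
      apply Real.exp_le_exp.mpr
      nlinarith
    have h8 := Real.exp_pos (-(T * (e.1 p + e.2.2)))
    rw [g3] at h3
    linarith
  · rcases F.S e he p hpk p.2 with h3 | ⟨e', he', g1, ν, g2, g3, g4⟩
    · exfalso
      have h4 := hlow (π p)
      have h5 : Real.exp (-(T * (e.1 p + 2 * e.2.2))) ≤ Real.exp (-(T * Ω)) :=
        gac_exp_le hT0 (by linarith)
      linarith
    · refine ⟨1 / 2 * Real.exp (-(T * (e.1 p + e.2.2))), by positivity, ?_, ?_⟩
      · have h3 := hB π e' he'
        set W := Real.exp lam * Real.exp (-(T * (e.1 p + 2 * e.2.2))) with hW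
        have hW0 : 0 ≤ W := by positivity
        have hΛ0 : 0 ≤ Λ := (F.nonneg e he k hk).trans (F.bdd e he k hk)
        have h4 : ∑ q : Fin n, e'.1 q * z (π q) ≤ ∑ q : Fin n, (e.1 q * z (π q) + Λ * W) := by
          refine sum_le_sum fun q _ => ?_
          have hnn := mul_nonneg (F.nonneg e he q q.2) (hz0 (π q))
          rcases lt_or_ge (q : ℕ) p with h | h
          · rw [g1 q h]
            have : 0 ≤ Λ * W := by positivity
            linarith
          · rw [g3 q h q.2]
            have h5 := hsmall q h
            have h6 : ν * z (π q) ≤ Λ * W := mul_le_mul g2 h5 (hz0 _) hΛ0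
            linarith
        rw [sum_add_distrib, sum_const, card_univ, Fintype.card_fin, nsmul_eq_mul] at h4
        have h5 : ∑ q : Fin n, e.1 q * z (π q) = ∑ q : Fin n, e.1 q * z q := by
          rw [← Equiv.sum_comp π (fun q : Fin n => e.1 q * z q)]
          exact sum_congr rfl fun q _ => by rw [hπa]
        rw [h5] at h4
        have h6 := mul_le_mul_of_nonneg_right hnL hW0
        linarith
      · intro q hq
        by_contra hcon
        push Not at hcon
        obtain ⟨m1, m2⟩ := hPmem q hq hcon.1
        have h4 := F.mon e he p _ (hpmin _ m1) (π.symm q).2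
        rw [m2] at h4
        have h5 : Real.exp (-(T * (e.1 q + e.2.2))) ≤ Real.exp (-(T * (e.1 p + e.2.2))) :=
          gac_exp_le hT0 (by linarith)
        linarith [hcon.2]


theorem gac_mono_le {n : ℕ} (X b : Fin n → ℝ) (η : Fin n → ℕ) (h0 : ∀ j, 0 ≤ X j)
    (h : ∀ j, X j ≤ Real.exp (b j)) : mono X η ≤ Real.exp (∑ j, (η j : ℝ) * b j) := by
  unfold mono
  rw [Real.exp_sum]
  refine prod_le_prod (fun j _ => pow_nonneg (h0 j) _) fun j _ => ?_
  rw [Real.exp_nat_mul]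
  exact pow_le_pow_left₀ (h0 j) (h j) _

theorem gac_mono_ge {n : ℕ} (X b : Fin n → ℝ) (η : Fin n → ℕ)
    (h : ∀ j, η j ≠ 0 → Real.exp (b j) ≤ X j) : Real.exp (∑ j, (η j : ℝ) * b j) ≤ mono X η := by
  unfold mono
  rw [Real.exp_sum]
  refine prod_le_prod (fun j _ => (Real.exp_pos _).le) fun j _ => ?_
  rw [Real.exp_nat_mul]
  by_cases hj : η j = 0
  · rw [hj]; simp
  · exact pow_le_pow_left₀ (Real.exp_pos _).le (h j hj) _

theorem gac_mono_nonneg {n : ℕ} (X : Fin n → ℝ) (η : Fin n → ℕ) (h0 : ∀ j, 0 ≤ X j) :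
    0 ≤ mono X η := prod_nonneg fun j _ => pow_nonneg (h0 j) _

def gS {n : ℕ} (N : Fin n → ℝ) (η : Fin n → ℕ) : ℝ := ∑ j, N j * (η j : ℝ)

theorem gac_pair {n r : ℕ} (y y' : Fin r → Fin n → ℕ) (f : Fin r → ℝ) (hf : ∀ i, 0 < f i)
    (hbal : ∀ φ : (Fin n → ℕ) → ℝ, ∑ i, f i * (φ (y' i) - φ (y i)) = 0)
    (N : Fin n → ℝ) (i0 : Fin r) (hdown : gS N (y' i0) < gS N (y i0)) :
    ∃ j, gS N (y j) < gS N (y i0) ∧ gS N (y j) < gS N (y' j) ∧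
      f i0 * (gS N (y i0) - gS N (y' i0)) ≤ r * f j * (gS N (y' j) - gS N (y j)) := by
  set φ : (Fin n → ℕ) → ℝ := fun η => min (gS N η) (gS N (y i0)) with hφ
  set D := f i0 * (gS N (y i0) - gS N (y' i0)) with hD
  have hD0 : 0 < D := mul_pos (hf i0) (sub_pos.mpr hdown)
  have hr : (0 : ℝ) < r := by
    have : 0 < r := i0.pos
    exact_mod_cast this
  have hb := hbal φ
  have hi0 : f i0 * (φ (y' i0) - φ (y i0)) = -D := by
    simp only [hφ, hD]
    rw [min_eq_left hdown.le, min_self]; ring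
  have hex : ∃ j, D / r ≤ f j * (φ (y' j) - φ (y j)) := by
    by_contra hcon
    push Not at hcon
    have h1 : ∑ j, (D / r - f j * (φ (y' j) - φ (y j))) = D := by
      rw [sum_sub_distrib, hb, sum_const, card_univ, Fintype.card_fin, nsmul_eq_mul]
      field_simp; ring
    have h2 := single_le_sum (f := fun j => D / r - f j * (φ (y' j) - φ (y j)))
      (fun j _ => (sub_pos.mpr (hcon j)).le) (mem_univ i0)
    rw [h1, hi0] at h2
    have : 0 < D / r := by positivity
    linarith
  obtain ⟨j, hj⟩ := hex
  have hpos : 0 < f j * (φ (y' j) - φ (y j)) := lt_of_lt_of_le (by positivity) hj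
  have hφpos : 0 < φ (y' j) - φ (y j) := (pos_iff_pos_of_mul_pos hpos).mp (hf j)
  have h1 : gS N (y j) < gS N (y i0) := by
    by_contra hcon
    push Not at hcon
    have e1 : φ (y j) = gS N (y i0) := min_eq_right hcon
    have e2 : φ (y' j) ≤ gS N (y i0) := min_le_right _ _
    linarith
  have e1 : φ (y j) = gS N (y j) := min_eq_left h1.le
  have e2 : φ (y' j) ≤ gS N (y' j) := min_le_left _ _
  refine ⟨j, h1, by linarith, ?_⟩
  rw [div_le_iff₀ hr] at hj
  have h3 : f j * (φ (y' j) - φ (y j)) ≤ f j * (gS N (y' j) - gS N (y j)) :=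
    mul_le_mul_of_nonneg_left (by linarith) (hf j).le
  nlinarith

theorem gac_loss {n r : ℕ} (y y' : Fin r → Fin n → ℕ) (f : Fin r → ℝ) (hf : ∀ i, 0 < f i)
    (hbal : ∀ φ : (Fin n → ℕ) → ℝ, ∑ i, f i * (φ (y' i) - φ (y i)) = 0)
    (N : Fin n → ℝ) (hN0 : ∀ j, 0 ≤ N j) (Y K d T lam s : ℝ) (hY0 : 0 ≤ Y)
    (hY : ∀ i, ∑ j, (y i j : ℝ) ≤ Y) (hNY : ∀ i, gS N (y i) ≤ Real.exp lam)
    (hcoh : ∀ i j, gS N (y j) < gS N (y i) → gS N (y j) + K * d ≤ gS N (y i))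
    (Xm Xp : Fin n → ℝ) (hXm : ∀ j, 0 ≤ Xm j) (hXp : ∀ j, 0 ≤ Xp j)
    (hup : ∀ j, Xp j ≤ Real.exp lam * Real.exp (-(T * (N j - d)))) (hs : 0 ≤ s)
    (hlow : ∀ j, Real.exp (-(T * (N j + 2 * d))) ≤ Xm j ∨
      1 / 2 * Real.exp (-(T * (N j + d))) ≤ s)
    (U : Fin r → ℝ) (hU1 : ∀ i, Real.exp (-lam) * mono Xm (y i) ≤ U i)
    (hU2 : ∀ i, U i ≤ Real.exp lam * mono Xp (y i))
    (hT0 : 0 ≤ T) (hd0 : 0 < d) (hlam : 0 ≤ lam) (hr : 2 * (r : ℝ) ≤ Real.exp lam)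
    (hff : ∀ i j, r * f j ≤ Real.exp lam * f i) (hK : 3 * Y + 10 ≤ K)
    (hlT : (Y + 10) * lam ≤ T * d) :
    -s ≤ ∑ i, U i * (gS N (y' i) - gS N (y i)) := by
  have hU0 : ∀ i, 0 ≤ U i := fun i =>
    (mul_nonneg (Real.exp_pos _).le (gac_mono_nonneg Xm (y i) hXm)).trans (hU1 i)
  set w : Fin r → ℝ := fun i => gS N (y' i) - gS N (y i) with hw
  set G := ∑ i, max (U i * w i) 0 with hG
  have hG0 : 0 ≤ G := sum_nonneg fun i _ => le_max_right _ _
  have hNη : ∀ η : Fin n → ℕ, 0 ≤ gS N η := fun η =>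
    sum_nonneg fun j _ => mul_nonneg (hN0 j) (Nat.cast_nonneg _)
  have hTd : 0 ≤ T * d := by positivity
  have hmp : ∀ i, mono Xp (y i) ≤ Real.exp (-(T * gS N (y i)) + Y * (lam + T * d)) := by
    intro i
    refine (gac_mono_le Xp (fun j => lam - T * (N j - d)) (y i) hXp fun j => ?_).trans ?_
    · refine (hup j).trans (le_of_eq ?_)
      rw [← Real.exp_add]; ring_nf
    · apply Real.exp_le_exp.mpr
      have e1 : ∑ j, (y i j : ℝ) * (lam - T * (N j - d)) =
          -(T * gS N (y i)) + (∑ j, (y i j : ℝ)) * (lam + T * d) := by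
        unfold gS
        rw [mul_sum, sum_mul, ← sum_neg_distrib, ← sum_add_distrib]
        exact sum_congr rfl fun j _ => by ring
      rw [e1]
      have := mul_le_mul_of_nonneg_right (hY i) (show 0 ≤ lam + T * d by positivity)
      linarith
  have hmain : ∀ i, max (-(U i * w i)) 0 ≤ (G + s) / r := by
    intro i
    have hr0 : (0 : ℝ) < r := by
      have : 0 < r := i.pos
      exact_mod_cast this
    refine max_le ?_ (by positivity)
    rcases le_or_gt (gS N (y i)) (gS N (y' i)) with h | h
    · have : 0 ≤ U i * w i := mul_nonneg (hU0 i) (sub_nonneg.mpr h)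
      have : 0 ≤ (G + s) / r := by positivity
      linarith
    obtain ⟨j, h1, h2, h3⟩ := gac_pair y y' f hf hbal N i h
    have hc := hcoh i j h1
    rw [le_div_iff₀ hr0]
    have hUi := (hU2 i).trans (mul_le_mul_of_nonneg_left (hmp i) (Real.exp_pos lam).le)
    have hwi : 0 ≤ -w i := by simp only [hw]; linarith
    by_cases hvio : ∃ l, y j l ≠ 0 ∧ Xm l < Real.exp (-(T * (N l + 2 * d)))
    · obtain ⟨l, hl, hlx⟩ := hvio
      have hs2 : 1 / 2 * Real.exp (-(T * (N l + d))) ≤ s := by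
        rcases hlow l with h4 | h4
        · linarith
        · exact h4
      have hNl : N l ≤ gS N (y j) := by
        have h5 := single_le_sum (f := fun j' => N j' * (y j j' : ℝ))
          (fun j' _ => mul_nonneg (hN0 j') (Nat.cast_nonneg _)) (mem_univ l)
        have h6 : (1 : ℝ) ≤ y j l := by exact_mod_cast Nat.one_le_iff_ne_zero.mpr hl
        have h7 := mul_le_mul_of_nonneg_left h6 (hN0 l)
        unfold gS
        linarith
      have hwi2 : -w i ≤ Real.exp lam := by
        have := hNη (y' i); have := hNY i
        simp only [hw]; linarith
      have h8 : U i * (-w i) ≤ Real.exp lam * Real.exp (-(T * gS N (y i)) + Y * (lam + T * d)) *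
          Real.exp lam := mul_le_mul hUi hwi2 hwi (by positivity)
      have h9 : (Real.exp lam * Real.exp (-(T * gS N (y i)) + Y * (lam + T * d)) *
          Real.exp lam) * Real.exp lam ≤ Real.exp (-(T * (N l + d))) := by
        rw [← Real.exp_add, ← Real.exp_add, ← Real.exp_add]
        apply Real.exp_le_exp.mpr
        have h10 : T * (N l + K * d) ≤ T * gS N (y i) :=
          mul_le_mul_of_nonneg_left (by linarith) hT0
        have h11 : (3 * Y + 10) * (T * d) ≤ K * (T * d) := mul_le_mul_of_nonneg_right hK hTd
        have h12 : 0 ≤ Y * (T * d) := by positivity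
        have h13 : 0 ≤ Y * lam := by positivity
        nlinarith
      have h14 : U i * (-w i) * (2 * r) ≤ Real.exp (-(T * (N l + d))) :=
        (mul_le_mul h8 hr (by positivity) (by positivity)).trans h9
      nlinarith
    · push Not at hvio
      have hmj := gac_mono_ge Xm (fun l => -(T * (N l + 2 * d))) (y j) hvio
      have e1 : ∑ l, (y j l : ℝ) * (-(T * (N l + 2 * d))) =
          -(T * gS N (y j)) - (∑ l, (y j l : ℝ)) * (2 * (T * d)) := by
        unfold gS
        rw [mul_sum, sum_mul, ← sum_neg_distrib, ← sum_sub_distrib]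
        exact sum_congr rfl fun j _ => by ring
      rw [e1] at hmj
      have h4 : Real.exp (-(T * gS N (y j)) - Y * (2 * (T * d))) ≤ mono Xm (y j) := by
        refine le_trans ?_ hmj
        apply Real.exp_le_exp.mpr
        have := mul_le_mul_of_nonneg_right (hY j) (show 0 ≤ 2 * (T * d) by positivity)
        linarith
      have hUj : Real.exp (-lam) * Real.exp (-(T * gS N (y j)) - Y * (2 * (T * d))) ≤ U j :=
        (mul_le_mul_of_nonneg_left h4 (Real.exp_pos _).le).trans (hU1 j)
      have hwj : 0 < w j := sub_pos.mpr h2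
      have hwi2 : -w i ≤ Real.exp lam * w j := by
        have h5 := mul_le_mul_of_nonneg_right (hff i j) hwj.le
        have h6 : f i * (-w i) ≤ f i * (Real.exp lam * w j) := by
          simp only [hw] at h5 ⊢
          linarith
        exact le_of_mul_le_mul_left h6 (hf i)
      have h8 : U i * (-w i) ≤ Real.exp lam * Real.exp (-(T * gS N (y i)) + Y * (lam + T * d)) *
          (Real.exp lam * w j) := mul_le_mul hUi hwi2 hwi (by positivity)
      have h9 : Real.exp lam * Real.exp (-(T * gS N (y i)) + Y * (lam + T * d)) * Real.exp lam *
          Real.exp lam ≤ Real.exp (-lam) * Real.exp (-(T * gS N (y j)) - Y * (2 * (T * d))) := by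
        rw [← Real.exp_add, ← Real.exp_add, ← Real.exp_add, ← Real.exp_add]
        apply Real.exp_le_exp.mpr
        have h10 : T * (gS N (y j) + K * d) ≤ T * gS N (y i) :=
          mul_le_mul_of_nonneg_left hc hT0
        have h11 : (3 * Y + 10) * (T * d) ≤ K * (T * d) := mul_le_mul_of_nonneg_right hK hTd
        have h13 : 0 ≤ Y * lam := by positivity
        nlinarith
      have h14 : U i * (-w i) * r ≤ U j * w j := by
        have hrl : (r : ℝ) ≤ Real.exp lam := by linarith
        calc U i * (-w i) * r ≤ (Real.exp lam * Real.exp (-(T * gS N (y i)) + Y * (lam + T * d)) *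
              (Real.exp lam * w j)) * Real.exp lam :=
              mul_le_mul h8 hrl hr0.le (by positivity)
          _ = (Real.exp lam * Real.exp (-(T * gS N (y i)) + Y * (lam + T * d)) * Real.exp lam *
              Real.exp lam) * w j := by ring
          _ ≤ (Real.exp (-lam) * Real.exp (-(T * gS N (y j)) - Y * (2 * (T * d)))) * w j :=
              mul_le_mul_of_nonneg_right h9 hwj.le
          _ ≤ U j * w j := mul_le_mul_of_nonneg_right hUj hwj.le
      have h15 : U j * w j ≤ G := (le_max_left _ _).trans
        (single_le_sum (f := fun i => max (U i * w i) 0) (fun i _ => le_max_right _ _) (mem_univ j))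
      linarith
  have hsum : ∑ i, max (-(U i * w i)) 0 ≤ G + s := by
    have h1 := sum_le_card_nsmul (univ : Finset (Fin r)) _ _ (fun i _ => hmain i)
    rw [card_univ, Fintype.card_fin, nsmul_eq_mul] at h1
    refine h1.trans ?_
    rcases Nat.eq_zero_or_pos r with h | h
    · subst h; simp; linarith
    · have : (r : ℝ) ≠ 0 := by exact_mod_cast h.ne'
      rw [mul_div_cancel₀ _ this]
  have hsplit : ∑ i, U i * w i = G - ∑ i, max (-(U i * w i)) 0 := by
    rw [hG, ← sum_sub_distrib]
    refine sum_congr rfl fun i _ => ?_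
    rcases le_total (U i * w i) 0 with h | h
    · rw [max_eq_right h, max_eq_left (by linarith)]; ring
    · rw [max_eq_left h, max_eq_right (by linarith)]; ring
  show -s ≤ ∑ i, U i * w i
  linarith


def gB {n : ℕ} (L : ℕ → Set ((ℕ → ℝ) × ℝ × ℝ)) (X : Fin n → ℝ) : Prop :=
  ∀ k < n, ∀ σ : Equiv.Perm (Fin n), ∀ e ∈ L k, e.2.1 ≤ ∑ q : Fin n, e.1 q * X (σ q)

theorem gB_low {n r : ℕ} {y : Fin r → Fin n → ℕ} {K d0 Ω Λ T : ℝ}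
    {L : ℕ → Set ((ℕ → ℝ) × ℝ × ℝ)} (F : GFam y (n-1) K d0 Ω Λ T (L (n-1)))
    (X : Fin n → ℝ) (hB : gB L X) (j : Fin n) : Real.exp (-T) ≤ X j := by
  have hn : 0 < n := j.pos
  obtain ⟨e, he, g1, g2, g3⟩ := F.ones
  have h := hB (n-1) (by omega) (Equiv.swap ⟨n-1, by omega⟩ j) e he
  rw [g3] at h
  refine h.trans (le_of_eq ?_)
  rw [sum_eq_single ⟨n-1, by omega⟩]
  · simp only []
    rw [g2 (n-1) le_rfl (by omega), Equiv.swap_apply_left, one_mul]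
  · intro b _ hb
    have : (b : ℕ) ≠ n - 1 := fun h => hb (Fin.ext h)
    rw [g1 b (by omega), zero_mul]
  · intro h; exact absurd (mem_univ _) h

theorem gac_step {n r : ℕ} (y y' : Fin r → Fin n → ℕ) (f : Fin r → ℝ) (hf : ∀ i, 0 < f i)
    (hbal : ∀ φ : (Fin n → ℕ) → ℝ, ∑ i, f i * (φ (y' i) - φ (y i)) = 0)
    (Y K d0 lam : ℝ) (hY0 : 0 ≤ Y) (hY : ∀ i, ∑ j, (y i j : ℝ) ≤ Y) (hd0 : 0 < d0) (hd1 : d0 ≤ 1 / 2)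
    (hlam : 0 ≤ lam) (hr : 2 * (r : ℝ) ≤ Real.exp lam)
    (hff : ∀ i j, r * f j ≤ Real.exp lam * f i) (hK : 3 * Y + 10 ≤ K)
    (L : ℕ → Set ((ℕ → ℝ) × ℝ × ℝ)) (Tk Ω Λ : ℕ → ℝ)
    (hF : ∀ k < n, GFam y k K d0 (Ω k) (Λ k) (Tk k) (L k))
    (hΩ : ∀ k < n, Tk (n-1) ≤ Tk k * Ω k)
    (hTT : ∀ k, k + 1 < n → Tk k ≤ Tk (k+1) * d0)
    (hTl : ∀ k < n, (Y + 10) * lam ≤ Tk k * d0)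
    (hnL : ∀ k < n, n * Λ k ≤ Real.exp lam) (hYL : ∀ k < n, Λ k * Y ≤ Real.exp lam)
    (h4 : 4 ≤ Real.exp lam) (hn : (n : ℝ) ≤ Real.exp lam)
    (Xm Xp : Fin n → ℝ) (hXm : ∀ j, 0 ≤ Xm j) (hXp : ∀ j, 0 ≤ Xp j)
    (hXb : ∀ j, Xp j ≤ Real.exp lam) (hXX : ∀ j, Xm j ≤ Real.exp lam * Xp j)
    (U : Fin r → ℝ) (hU1 : ∀ i, Real.exp (-lam) * mono Xm (y i) ≤ U i)
    (hU2 : ∀ i, U i ≤ Real.exp lam * mono Xp (y i))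
    (hX : ∀ j, Xp j = Xm j + ∑ i, U i * ((y' i j : ℝ) - y i j))
    (hB : gB L Xm) : gB L Xp := by
  intro k hk σ0 e0 he0
  by_contra hcon
  push Not at hcon
  have F := hF k hk
  set T := Tk k with hTdef
  have hlT := hTl k hk
  have hYl : 0 ≤ Y * lam := by positivity
  have hlT10 : 10 * lam ≤ T * d0 := by linarith
  have hT0 : 0 ≤ T := by
    by_contra h
    push Not at h
    have := mul_neg_of_neg_of_pos h hd0
    linarith
  obtain ⟨σ, hσ⟩ := gac_sort Xp
  set x : Fin n → ℝ := Xp ∘ σ with hx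
  set z : Fin n → ℝ := Xm ∘ σ with hz
  have hviol : ∑ q : Fin n, e0.1 q * x q < e0.2.1 :=
    (gac_rearr Xp (fun q : Fin n => e0.1 q) (fun i j hij => F.mon e0 he0 i j hij j.2) σ σ0 hσ).trans_lt hcon
  obtain ⟨e, heL, hemin⟩ := F.fin.toFinset.exists_min_image
    (fun e => ∑ q : Fin n, e.1 q * x q - e.2.1) ⟨e0, F.fin.mem_toFinset.mpr he0⟩
  have he : e ∈ L k := F.fin.mem_toFinset.mp heL
  have hmin : ∀ e' ∈ L k, ∑ q : Fin n, e.1 q * x q - e.2.1 ≤ ∑ q : Fin n, e'.1 q * x q - e'.2.1 :=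
    fun e' he' => hemin e' (F.fin.mem_toFinset.mpr he')
  have hneg : ∑ q : Fin n, e.1 q * x q < e.2.1 := by
    have := hmin e0 he0
    linarith
  have hx0 : ∀ q, 0 ≤ x q := fun q => hXp (σ q)
  have hz0 : ∀ q, 0 ≤ z q := fun q => hXm (σ q)
  have hexpT : Real.exp lam ≤ Real.exp (T * d0) := Real.exp_le_exp.mpr (by linarith)
  have hd := F.dle e he
  have hTd : T * d0 ≤ T * e.2.2 := mul_le_mul_of_nonneg_left hd hT0
  have hcell : ∀ q : Fin n, k ≤ q → x q ≤ Real.exp (-(T * (e.1 q - e.2.2))) := fun q hq =>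
    gac_cell F x hx0 hσ e he hneg hmin hT0 (by linarith) q hq q.2
  have hzx : ∀ q, z q ≤ Real.exp lam * x q := fun q => hXX (σ q)
  have hlow : ∀ j, Real.exp (-(T * Ω k)) ≤ Xm j := fun j =>
    (Real.exp_le_exp.mpr (neg_le_neg (hΩ k hk))).trans (gB_low (hF (n-1) (by omega)) Xm hB j)
  have hBz : ∀ k' < n, ∀ π : Equiv.Perm (Fin n), ∀ e' ∈ L k', e'.2.1 ≤ ∑ q : Fin n, e'.1 q * z (π q) := by
    intro k' hk' π e' he'
    exact hB k' hk' (π.trans σ) e' he'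
  -- heavy bound
  have hheavy : ∀ i : Fin n, (i : ℕ) < k → Real.exp (-(T * (2 * e.2.2))) ≤ z i := by
    intro i hi
    have hk1 : k - 1 < n := by omega
    have F1 := hF (k-1) hk1
    obtain ⟨e1, he1, g1, g2, g3⟩ := F1.ones
    set p : Fin n := ⟨k-1, hk1⟩ with hp
    have h1 := hBz (k-1) hk1 (Equiv.swap p i) e1 he1
    have hlight : ∀ q : Fin n, k ≤ q → x q ≤ 2 * Real.exp (-T) := by
      intro q hq
      have h2 := single_le_sum (f := fun q : Fin n => e.1 q * x q)
        (fun i _ => mul_nonneg (F.nonneg e he i i.2) (hx0 i)) (mem_univ q)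
      have h3 := F.mon e he k q hq q.2
      rw [F.one e he] at h3
      have h5 := mul_le_mul_of_nonneg_right h3 (hx0 q)
      have h6 := F.C1 e he
      linarith
    set W := Real.exp lam * (2 * Real.exp (-T)) with hW
    have hW0 : 0 ≤ W := by positivity
    have h2 : ∑ q : Fin n, e1.1 q * z (Equiv.swap p i q) ≤
        ∑ q : Fin n, ((if q = p then z i else 0) + W) := by
      refine sum_le_sum fun q _ => ?_
      rcases lt_trichotomy (q : ℕ) (k-1) with h | h | h
      · rw [g1 q h, zero_mul, if_neg (by intro h'; rw [h'] at h; exact lt_irrefl _ h)]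
        linarith
      · have hqp : q = p := Fin.ext h
        rw [if_pos hqp, hqp, Equiv.swap_apply_left]
        have : e1.1 (p : ℕ) = 1 := g2 (k-1) le_rfl hk1
        rw [this]; linarith
      · have hqk : k ≤ q := by omega
        have n1 : q ≠ p := by intro h'; rw [h'] at h; exact lt_irrefl _ h
        have n2 : q ≠ i := by intro h'; rw [h'] at h; omega
        rw [if_neg n1, Equiv.swap_apply_of_ne_of_ne n1 n2, g2 q (by omega) q.2, one_mul, zero_add]
        exact (hzx q).trans (mul_le_mul_of_nonneg_left (hlight q hqk) (Real.exp_pos _).le)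
    rw [sum_add_distrib, sum_ite_eq' univ p, if_pos (mem_univ _), sum_const, card_univ,
      Fintype.card_fin, nsmul_eq_mul] at h2
    have hTk := hTT (k-1) (by omega)
    have ek : k - 1 + 1 = k := by omega
    rw [ek] at hTk
    have hTd2 : T * d0 ≤ T * (1/2) := mul_le_mul_of_nonneg_left hd1 hT0
    rw [g3] at h1
    have h5 : n * W * 2 ≤ Real.exp (-Tk (k-1)) := by
      have h6 : n * W * 2 ≤ Real.exp lam * (Real.exp lam * (Real.exp lam * Real.exp (-T))) := by
        have h7 : W * 2 ≤ Real.exp lam * (Real.exp lam * Real.exp (-T)) := by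
          have : 0 ≤ Real.exp lam * Real.exp (-T) := by positivity
          rw [hW]; nlinarith
        have := mul_le_mul hn h7 (by positivity) (Real.exp_pos _).le
        linarith
      refine h6.trans ?_
      rw [← Real.exp_add, ← Real.exp_add, ← Real.exp_add]
      apply Real.exp_le_exp.mpr
      linarith
    have h6 : Real.exp (-(T * (2 * e.2.2))) * 2 ≤ Real.exp (-Tk (k-1)) := by
      have h7 : Real.exp (-(T * (2 * e.2.2))) * Real.exp lam ≤ Real.exp (-Tk (k-1)) := by
        rw [← Real.exp_add]
        apply Real.exp_le_exp.mpr
        linarith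
      have := Real.exp_pos (-(T * (2 * e.2.2)))
      nlinarith
    linarith
  obtain ⟨s, hs, hs1, hs2⟩ := gac_slack (lam := lam) F hk z hz0 e he (hBz k hk)
    (fun q hq => (hzx q).trans (mul_le_mul_of_nonneg_left (hcell q hq) (Real.exp_pos _).le))
    (fun q => hlow (σ q)) (by linarith) hd0 hT0 hlam (by linarith) (hnL k hk) (by linarith) hn
  set N : Fin n → ℝ := fun j => e.1 (σ.symm j) with hN
  have hsumN : ∀ g : Fin n → ℝ, ∑ j, N j * g j = ∑ q : Fin n, e.1 q * g (σ q) := by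
    intro g
    rw [← Equiv.sum_comp σ]
    exact sum_congr rfl fun q _ => by simp [hN]
  have hgS : ∀ η : Fin n → ℕ, gS N η = ∑ q : Fin n, e.1 q * (η (σ q) : ℝ) := fun η =>
    hsumN (fun j => (η j : ℝ))
  have hΛY : ∀ i, gS N (y i) ≤ Real.exp lam := by
    intro i
    refine le_trans ?_ (hYL k hk)
    have hΛ0 : 0 ≤ Λ k := (F.nonneg e he k hk).trans (F.bdd e he k hk)
    calc gS N (y i) ≤ ∑ j, Λ k * (y i j : ℝ) :=
          sum_le_sum fun j _ => mul_le_mul_of_nonneg_right (F.bdd e he _ (σ.symm j).2) (Nat.cast_nonneg _)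
      _ = Λ k * ∑ j, (y i j : ℝ) := by rw [mul_sum]
      _ ≤ Λ k * Y := mul_le_mul_of_nonneg_left (hY i) hΛ0
  have hloss := gac_loss y y' f hf hbal N (fun j => F.nonneg e he _ (σ.symm j).2) Y K e.2.2 T lam s hY0 hY
    hΛY (fun i j h => by
      rw [hgS, hgS] at h ⊢
      exact F.coh e he σ i j h) Xm Xp hXm hXp (fun j => by
      rcases lt_or_ge ((σ.symm j : Fin n) : ℕ) k with h | h
      · have hNj : N j = 0 := F.zero e he _ h
        rw [hNj]
        refine (hXb j).trans (le_mul_of_one_le_right (Real.exp_pos _).le (Real.one_le_exp ?_))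
        nlinarith
      · have h1 := hcell (σ.symm j) h
        have h2 : x (σ.symm j) = Xp j := by simp [hx]
        rw [h2] at h1
        exact h1.trans (le_mul_of_one_le_left (Real.exp_pos _).le (by linarith))) hs (fun j => by
      rcases lt_or_ge ((σ.symm j : Fin n) : ℕ) k with h | h
      · left
        have hNj : N j = 0 := F.zero e he _ h
        have h1 := hheavy (σ.symm j) h
        have h2 : z (σ.symm j) = Xm j := by simp [hz]
        rw [h2] at h1
        rw [hNj, zero_add]; exact h1
      · have h1 := hs2 (σ.symm j) h
        have h2 : z (σ.symm j) = Xm j := by simp [hz]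
        rw [h2] at h1
        exact h1) U hU1 hU2 hT0 (by linarith) hlam hr hff hK (by linarith)
  have e1 : ∑ q : Fin n, e.1 q * x q = ∑ q : Fin n, e.1 q * z q +
      ∑ i, U i * (gS N (y' i) - gS N (y i)) := by
    have a1 : ∑ q : Fin n, e.1 q * x q = ∑ j, N j * Xp j := (hsumN Xp).symm
    have a2 : ∑ q : Fin n, e.1 q * z q = ∑ j, N j * Xm j := (hsumN Xm).symm
    rw [a1, a2]
    have a3 : ∑ i, U i * (gS N (y' i) - gS N (y i)) =
        ∑ i, ∑ j, N j * (U i * ((y' i j : ℝ) - y i j)) := by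
      refine sum_congr rfl fun i _ => ?_
      unfold gS
      rw [← sum_sub_distrib, mul_sum]
      exact sum_congr rfl fun j _ => by ring
    rw [a3, sum_comm, ← sum_add_distrib]
    refine sum_congr rfl fun j _ => ?_
    rw [hX j, mul_add, mul_sum]
  linarith


theorem gac_minpos (g : ℕ → ℝ) (n : ℕ) (hg : ∀ k < n, 0 < g k) :
    ∃ d : ℝ, 0 < d ∧ d ≤ 1 / 2 ∧ ∀ k < n, d ≤ g k := by
  induction n with
  | zero => exact ⟨1/2, by norm_num, le_rfl, fun k hk => absurd hk (Nat.not_lt_zero k)⟩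
  | succ n ih =>
    obtain ⟨d, h1, h2, h3⟩ := ih fun k hk => hg k (by omega)
    refine ⟨min d (g n), lt_min h1 (hg n (by omega)), (min_le_left _ _).trans h2, fun k hk => ?_⟩
    rcases Nat.lt_succ_iff_lt_or_eq.mp hk with h | h
    · exact (min_le_left _ _).trans (h3 k h)
    · subst h; exact min_le_right _ _

theorem GFam.weaken {n r : ℕ} {y : Fin r → Fin n → ℕ} {k : ℕ} {K d0 d1 Ω Λ T : ℝ}
    {L : Set ((ℕ → ℝ) × ℝ × ℝ)} (F : GFam y k K d0 Ω Λ T L) (h : d1 ≤ d0) :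
    GFam y k K d1 Ω Λ T L :=
  ⟨F.fin, F.ones, F.zero, F.one, F.mon, F.nonneg, F.bdd, F.C0, F.C1,
    fun e he => h.trans (F.dle e he), F.coh, F.coh2, F.S, F.S'⟩

theorem gac_barrier {n r : ℕ} (y y' : Fin r → Fin n → ℕ) (f : Fin r → ℝ) (hf : ∀ i, 0 < f i)
    (hbal : ∀ φ : (Fin n → ℕ) → ℝ, ∑ i, f i * (φ (y' i) - φ (y i)) = 0)
    (Mc μ : ℝ) (hMc : 1 ≤ Mc) (hμ : 0 < μ) :
    ∃ (B : (Fin n → ℝ) → Prop) (δ : ℝ), 0 < δ ∧ (∀ X, B X → ∀ j, δ ≤ X j) ∧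
      (∀ X : Fin n → ℝ, (∀ j, μ ≤ X j) → B X) ∧
      (∀ (Xm Xp : Fin n → ℝ) (U : Fin r → ℝ), (∀ j, 0 ≤ Xm j) → (∀ j, 0 ≤ Xp j) →
        (∀ j, Xp j ≤ Mc) → (∀ j, Xm j ≤ Mc * Xp j) →
        (∀ i, mono Xm (y i) ≤ Mc * U i) → (∀ i, U i ≤ Mc * mono Xp (y i)) →
        (∀ j, Xp j = Xm j + ∑ i, U i * ((y' i j : ℝ) - y i j)) → B Xm → B Xp) := by
  rcases Nat.eq_zero_or_pos n with hn0 | hn0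
  · subst hn0
    exact ⟨fun _ => True, 1, one_pos, fun X _ j => j.elim0, fun _ _ => trivial,
      fun _ _ _ _ _ _ _ _ _ _ _ => trivial⟩
  set Y : ℝ := ∑ i, ∑ j, (y i j : ℝ) with hYdef
  have hY0 : 0 ≤ Y := sum_nonneg fun i _ => sum_nonneg fun j _ => Nat.cast_nonneg _
  have hY : ∀ i, ∑ j, (y i j : ℝ) ≤ Y := fun i =>
    single_le_sum (f := fun i => ∑ j, (y i j : ℝ))
      (fun i _ => sum_nonneg fun j _ => Nat.cast_nonneg _) (mem_univ i)
  set K : ℝ := 3 * Y + 10 with hK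
  have hfam : ∀ k, ∃ d0 : ℝ, k < n → 0 < d0 ∧ ∀ Ω : ℝ, ∃ Λ : ℝ, ∃ T0 : ℝ, ∀ T ≥ T0, ∃ L,
      GFam y k K d0 Ω Λ T L := by
    intro k
    by_cases hk : k < n
    · obtain ⟨d0, h⟩ := gac_fam y K (by linarith) k hk
      exact ⟨d0, fun _ => h⟩
    · exact ⟨0, fun h => absurd h hk⟩
  choose dk hdk using hfam
  obtain ⟨d0, hd0, hd1, hdle⟩ := gac_minpos dk n fun k hk => (hdk k hk).1
  set Q : ℝ := 1 / d0 with hQ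
  have hQ1 : 1 ≤ Q := by rw [hQ, le_div_iff₀ hd0]; linarith
  have hQd : Q * d0 = 1 := by rw [hQ]; field_simp
  have hΛex : ∀ k, ∃ Λ T0 : ℝ, k < n → ∀ T ≥ T0, ∃ L, GFam y k K (dk k) (Q ^ (n-1-k)) Λ T L := by
    intro k
    by_cases hk : k < n
    · obtain ⟨Λ, T0, h⟩ := (hdk k hk).2 (Q ^ (n-1-k))
      exact ⟨Λ, T0, fun _ => h⟩
    · exact ⟨0, 0, fun h => absurd h hk⟩
  choose Λ T0 hL using hΛex
  set A1 : ℝ := ∑ i, ∑ j, r * f j / f i with hA1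
  set A2 : ℝ := ∑ k ∈ range n, (n * |Λ k| + |Λ k| * Y) with hA2
  have hA1t : ∀ i j, 0 ≤ r * f j / f i := fun i j =>
    div_nonneg (mul_nonneg (Nat.cast_nonneg _) (hf j).le) (hf i).le
  have hA2t : ∀ k, 0 ≤ n * |Λ k| + |Λ k| * Y := fun k => by positivity
  have hA10 : 0 ≤ A1 := sum_nonneg fun i _ => sum_nonneg fun j _ => hA1t i j
  have hA20 : 0 ≤ A2 := sum_nonneg fun k _ => hA2t k
  set lam : ℝ := 4 + n + 2 * r + Mc + A1 + A2 with hlam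
  have hlam0 : 0 ≤ lam := by positivity
  have hle : lam ≤ Real.exp lam := by
    have := Real.add_one_le_exp lam
    linarith
  have hnn : (0:ℝ) ≤ n := Nat.cast_nonneg _
  have hrr : (0:ℝ) ≤ r := Nat.cast_nonneg _
  set T : ℝ := ∑ k ∈ range n, |T0 k| + (Y + 10) * lam / d0 + 2 / μ with hT
  have hs0 : 0 ≤ ∑ k ∈ range n, |T0 k| := sum_nonneg fun k _ => abs_nonneg _
  have hs1 : 0 ≤ (Y + 10) * lam / d0 := by positivity
  have hs2 : 0 ≤ 2 / μ := by positivity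
  have hTnn : 0 ≤ T := by positivity
  have hTk : ∀ k, T ≤ T * Q ^ k := fun k => le_mul_of_one_le_right hTnn (one_le_pow₀ hQ1)
  have hLex : ∀ k, ∃ L, k < n → GFam y k K d0 (Q ^ (n-1-k)) (Λ k) (T * Q^k) L := by
    intro k
    by_cases hk : k < n
    · have h1 := single_le_sum (f := fun k => |T0 k|) (s := range n) (fun k _ => abs_nonneg _)
        (mem_range.mpr hk)
      have h2 := le_abs_self (T0 k)
      obtain ⟨L, h⟩ := hL k hk (T * Q^k) (by have := hTk k; linarith)
      exact ⟨L, fun _ => h.weaken (hdle k hk)⟩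
    · exact ⟨∅, fun h => absurd h hk⟩
  choose L hF using hLex
  have hTd0 : (Y + 10) * lam ≤ T * d0 := by
    rw [← div_le_iff₀ hd0]; linarith
  have hμT : 2 * Real.exp (-T) ≤ μ := by
    have h1 := Real.add_one_le_exp T
    have h2 : 2 / μ ≤ Real.exp T := by linarith
    rw [div_le_iff₀ hμ] at h2
    rw [Real.exp_neg]
    have := Real.exp_pos T
    rw [mul_inv_le_iff₀ this]
    linarith
  have hA2k : ∀ k < n, n * |Λ k| + |Λ k| * Y ≤ A2 := fun k hk =>
    single_le_sum (f := fun k => n * |Λ k| + |Λ k| * Y) (fun k _ => hA2t k) (mem_range.mpr hk)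
  refine ⟨gB L, Real.exp (-(T * Q^(n-1))), Real.exp_pos _, fun X hX j =>
    gB_low (hF (n-1) (by omega)) X hX j, ?_, ?_⟩
  · intro X hX k hk σ e he
    have F := hF k hk
    have h1 := F.C1 e he
    have h2 := single_le_sum (f := fun q : Fin n => e.1 q * X (σ q))
      (fun i _ => mul_nonneg (F.nonneg e he i i.2) (hμ.le.trans (hX (σ i)))) (mem_univ ⟨k, hk⟩)
    have h3 : e.1 k * X (σ ⟨k, hk⟩) ≤ ∑ q : Fin n, e.1 q * X (σ q) := h2
    rw [F.one e he, one_mul] at h3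
    have h4 := hX (σ ⟨k, hk⟩)
    have h5 : Real.exp (-(T * Q^k)) ≤ Real.exp (-T) := Real.exp_le_exp.mpr (neg_le_neg (hTk k))
    linarith
  · intro Xm Xp U hXm hXp hXb hXX hU1 hU2 hX hB
    have hMcl : Mc ≤ Real.exp lam := by linarith
    have hU0 : ∀ i, 0 ≤ U i := fun i => by
      have := (gac_mono_nonneg Xm (y i) hXm).trans (hU1 i)
      exact nonneg_of_mul_nonneg_right this (by linarith)
    refine gac_step y y' f hf hbal Y K d0 lam hY0 hY hd0 hd1 hlam0 (by linarith) ?_ le_rfl L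
      (fun k => T * Q^k) (fun k => Q^(n-1-k)) Λ hF ?_ ?_ ?_ ?_ ?_ (by linarith) (by linarith)
      Xm Xp hXm hXp (fun j => (hXb j).trans hMcl) (fun j => (hXX j).trans
        (mul_le_mul_of_nonneg_right hMcl (hXp j))) U ?_ ?_ hX hB
    · intro i j
      rw [← div_le_iff₀ (hf i)]
      have h1 := single_le_sum (f := fun j => r * f j / f i) (fun j _ => hA1t i j) (mem_univ j)
      have h2 := single_le_sum (f := fun i => ∑ j, r * f j / f i)
        (fun i _ => sum_nonneg fun j _ => hA1t i j) (mem_univ i)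
      linarith
    · intro k hk
      show T * Q^(n-1) ≤ T * Q^k * Q^(n-1-k)
      rw [mul_assoc, ← pow_add]
      have : k + (n-1-k) = n-1 := by omega
      rw [this]
    · intro k hk
      show T * Q^k ≤ T * Q^(k+1) * d0
      rw [pow_succ]
      have : T * (Q^k * Q) * d0 = T * Q^k * (Q * d0) := by ring
      rw [this, hQd, mul_one]
    · intro k hk
      exact hTd0.trans (mul_le_mul_of_nonneg_right (hTk k) hd0.le)
    · intro k hk
      have h1 := hA2k k hk
      have h2 : 0 ≤ |Λ k| * Y := by positivity
      have h3 := mul_le_mul_of_nonneg_left (le_abs_self (Λ k)) hnn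
      linarith
    · intro k hk
      have h1 := hA2k k hk
      have h2 : 0 ≤ n * |Λ k| := by positivity
      have h3 := mul_le_mul_of_nonneg_right (le_abs_self (Λ k)) hY0
      linarith
    · intro i
      rw [Real.exp_neg, inv_mul_le_iff₀ (Real.exp_pos _)]
      exact (hU1 i).trans (mul_le_mul_of_nonneg_right hMcl (hU0 i))
    · intro i
      exact (hU2 i).trans (mul_le_mul_of_nonneg_right hMcl (gac_mono_nonneg Xp (y i) hXp))


theorem gac_bal {n r : ℕ} (y y' : Fin r → Fin n → ℕ) (f : Fin r → ℝ)
    (h : ∀ η : Fin n → ℕ, ∑ i ∈ univ.filter (fun i => y i = η), f i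
      = ∑ i ∈ univ.filter (fun i => y' i = η), f i)
    (φ : (Fin n → ℕ) → ℝ) : ∑ i, f i * (φ (y' i) - φ (y i)) = 0 := by
  classical
  have key : ∀ z : Fin r → Fin n → ℕ, ∀ T : Finset (Fin n → ℕ), (∀ i, z i ∈ T) →
      ∑ i, f i * φ (z i) = ∑ η ∈ T, (∑ i ∈ univ.filter (fun i => z i = η), f i) * φ η := by
    intro z T hT
    rw [← Finset.sum_fiberwise_of_maps_to (s := univ) (t := T) (g := z) (fun i _ => hT i)]
    refine Finset.sum_congr rfl fun η _ => ?_
    rw [Finset.sum_mul]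
    refine Finset.sum_congr rfl fun i hi => ?_
    rw [(Finset.mem_filter.1 hi).2]
  have h1 := key y (univ.image y ∪ univ.image y') (fun i => by simp)
  have h2 := key y' (univ.image y ∪ univ.image y') (fun i => by simp)
  simp only [mul_sub, Finset.sum_sub_distrib]
  rw [h1, h2, sub_eq_zero]
  refine Finset.sum_congr rfl fun η _ => ?_
  have := h η
  congr 1
  convert this.symm

theorem gac_mono_mono {n : ℕ} (X Y : Fin n → ℝ) (η : Fin n → ℕ) (h0 : ∀ j, 0 ≤ X j)
    (h : ∀ j, X j ≤ Y j) : mono X η ≤ mono Y η := by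
  unfold mono
  exact Finset.prod_le_prod (fun j _ => pow_nonneg (h0 j) _)
    (fun j _ => pow_le_pow_left₀ (h0 j) (h j) _)

theorem gac_mono_scale {n : ℕ} (c : ℝ) (X : Fin n → ℝ) (η : Fin n → ℕ) :
    mono (fun j => c * X j) η = c ^ (∑ j, η j) * mono X η := by
  unfold mono
  simp only [mul_pow, Finset.prod_mul_distrib, Finset.prod_pow_eq_pow_sum]

theorem gac_mono_const {n : ℕ} (M : ℝ) (X : Fin n → ℝ) (η : Fin n → ℕ) (h0 : ∀ j, 0 ≤ X j)
    (h : ∀ j, X j ≤ M) : mono X η ≤ M ^ (∑ j, η j) := by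
  refine (gac_mono_mono X (fun _ => M) η h0 h).trans ?_
  unfold mono
  rw [Finset.prod_pow_eq_pow_sum]

theorem gac_mono_lin {n : ℕ} (M : ℝ) (hM : 1 ≤ M) (X : Fin n → ℝ) (η : Fin n → ℕ)
    (h0 : ∀ j, 0 ≤ X j) (h : ∀ j, X j ≤ M) (j : Fin n) :
    mono X η * (η j : ℝ) ≤ ((η j : ℝ) * M ^ (∑ j, η j)) * X j := by
  rcases Nat.eq_zero_or_pos (η j) with hz | hp
  · simp [hz]
  · have hM0 : (0:ℝ) ≤ M := by linarith
    have h1 : X j ^ (η j) ≤ X j * M ^ (η j) := by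
      obtain ⟨b, hb⟩ := Nat.exists_eq_succ_of_ne_zero hp.ne'
      rw [hb, Nat.succ_eq_add_one, pow_succ']
      refine mul_le_mul_of_nonneg_left ?_ (h0 j)
      exact (pow_le_pow_left₀ (h0 j) (h j) b).trans (pow_le_pow_right₀ hM (by omega))
    have h2 : mono X η ≤ X j * M ^ (∑ j, η j) := by
      unfold mono
      rw [← Finset.mul_prod_erase _ _ (Finset.mem_univ j), ← Finset.prod_pow_eq_pow_sum,
        ← Finset.mul_prod_erase _ (fun i => M ^ (η i)) (Finset.mem_univ j), ← mul_assoc]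
      refine mul_le_mul h1 ?_ (Finset.prod_nonneg fun i _ => pow_nonneg (h0 i) _)
        (mul_nonneg (h0 j) (pow_nonneg hM0 _))
      exact Finset.prod_le_prod (fun j _ => pow_nonneg (h0 j) _)
        (fun j _ => pow_le_pow_left₀ (h0 j) (h j) _)
    calc mono X η * (η j : ℝ) ≤ (X j * M ^ (∑ j, η j)) * (η j : ℝ) :=
          mul_le_mul_of_nonneg_right h2 (by positivity)
      _ = _ := by ring

theorem gac_mvt (G u : ℝ → ℝ) (hG : ∀ t, HasDerivAt G (u t) t) (a b lo hi : ℝ) (hab : a ≤ b)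
    (h : ∀ s ∈ Set.Icc a b, lo ≤ u s ∧ u s ≤ hi) :
    lo * (b - a) ≤ G b - G a ∧ G b - G a ≤ hi * (b - a) := by
  rcases hab.eq_or_lt with rfl | hlt
  · simp
  · obtain ⟨c, hc, hc2⟩ := exists_hasDerivAt_eq_slope G u hlt
      (fun t _ => (hG t).continuousAt.continuousWithinAt) (fun t _ => hG t)
    have hpos : 0 < b - a := by linarith
    have h3 : G b - G a = u c * (b - a) := by rw [hc2]; field_simp
    have h4 := h c ⟨hc.1.le, hc.2.le⟩
    rw [h3]
    exact ⟨mul_le_mul_of_nonneg_right h4.1 hpos.le, mul_le_mul_of_nonneg_right h4.2 hpos.le⟩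

theorem gac_mono_deriv (Z Z' : ℝ → ℝ) (a b : ℝ) (hab : a ≤ b)
    (hc : ContinuousOn Z (Set.Icc a b))
    (hd : ∀ s ∈ Set.Ioo a b, HasDerivAt Z (Z' s) s) (h : ∀ s ∈ Set.Ioo a b, 0 ≤ Z' s) :
    Z a ≤ Z b := by
  rcases hab.eq_or_lt with rfl | hlt
  · exact le_rfl
  · obtain ⟨c, hc1, hc2⟩ := exists_hasDerivAt_eq_slope Z Z' hlt hc hd
    have hpos : 0 < b - a := by linarith
    have h3 : Z b - Z a = Z' c * (b - a) := by rw [hc2]; field_simp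
    have := mul_nonneg (h c hc1) hpos.le
    linarith

theorem gac_core {n r : ℕ} (y y' : Fin r → Fin n → ℕ) (k τ : Fin r → ℝ) (τm : ℝ)
    (hk : ∀ i, 0 < k i) (hτ : ∀ i, 0 ≤ τ i) (hτm : ∀ i, τ i ≤ τm) (hτm0 : 0 ≤ τm)
    (f : Fin r → ℝ) (hf : ∀ i, 0 < f i)
    (hbal : ∀ φ : (Fin n → ℕ) → ℝ, ∑ i, f i * (φ (y' i) - φ (y i)) = 0)
    (x : ℝ → Fin n → ℝ) (M : ℝ) (hM : 1 ≤ M) (hcont : Continuous x)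
    (h0 : ∀ t j, 0 ≤ x t j) (hxM : ∀ t j, x t j ≤ M) (hinit : ∀ j, 0 < x 0 j)
    (hd : ∀ t > (0 : ℝ), ∀ j, HasDerivAt (fun t => x t j)
      (∑ i, k i * (mono (x (t - τ i)) (y i) * (y' i j : ℝ)
      - mono (x t) (y i) * (y i j : ℝ))) t) :
    ∃ ε > 0, ∃ T : ℝ, ∀ t ≥ T, ∀ j, ε ≤ x t j := by
  have hM0 : (0:ℝ) ≤ M := by linarith
  have hcj : ∀ j, Continuous (fun t => x t j) := fun j => (continuous_apply j).comp hcont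
  have hucont : ∀ i, Continuous (fun t => mono (x t) (y i)) := by
    intro i
    unfold mono
    exact continuous_finsetProd _ fun j _ => (hcj j).pow _
  have hu0 : ∀ i t, 0 ≤ mono (x t) (y i) := fun i t => gac_mono_nonneg _ _ (h0 t)
  have huM : ∀ i t, mono (x t) (y i) ≤ M ^ (∑ j, y i j) :=
    fun i t => gac_mono_const M _ _ (h0 t) (hxM t)
  obtain ⟨G, hG⟩ : ∃ G : Fin r → ℝ → ℝ, ∀ i t, HasDerivAt (G i) (mono (x t) (y i)) t :=
    ⟨fun i t => ∫ s in (0:ℝ)..t, mono (x s) (y i), fun i t =>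
      intervalIntegral.integral_hasDerivAt_right ((hucont i).intervalIntegrable _ _)
        ((hucont i).stronglyMeasurableAtFilter _ _) (hucont i).continuousAt⟩
  have hGm : ∀ i a b, a ≤ b → G i a ≤ G i b := by
    intro i a b hab
    have := (gac_mvt (G i) _ (hG i) a b 0 _ hab (fun s _ => ⟨hu0 i s, huM i s⟩)).1
    linarith
  -- the constant A
  set A : ℝ := ∑ j, ∑ i, k i * ((y i j : ℝ) * M ^ (∑ j, y i j)) with hA
  have hterm : ∀ i j, 0 ≤ k i * ((y i j : ℝ) * M ^ (∑ j, y i j)) := fun i j => by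
    have := hk i
    positivity
  have hA0 : 0 ≤ A := Finset.sum_nonneg fun j _ => Finset.sum_nonneg fun i _ => hterm i j
  have hloss : ∀ t j, ∑ i, k i * (mono (x t) (y i) * (y i j : ℝ)) ≤ A * x t j := by
    intro t j
    have h1 : ∑ i, k i * ((y i j : ℝ) * M ^ (∑ j, y i j)) ≤ A :=
      Finset.single_le_sum (f := fun j => ∑ i, k i * ((y i j : ℝ) * M ^ (∑ j, y i j)))
        (fun j _ => Finset.sum_nonneg fun i _ => hterm i j) (Finset.mem_univ j)
    refine le_trans ?_ (mul_le_mul_of_nonneg_right h1 (h0 t j))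
    rw [Finset.sum_mul]
    refine Finset.sum_le_sum fun i _ => ?_
    rw [mul_assoc]
    exact mul_le_mul_of_nonneg_left (gac_mono_lin M hM _ _ (h0 t) (hxM t) j) (hk i).le
  have hsplit : ∀ t j, (∑ i, k i * (mono (x (t - τ i)) (y i) * (y' i j : ℝ)
      - mono (x t) (y i) * (y i j : ℝ))) =
      (∑ i, k i * (y' i j : ℝ) * mono (x (t - τ i)) (y i)) -
        ∑ i, k i * (mono (x t) (y i) * (y i j : ℝ)) := by
    intro t j
    rw [← Finset.sum_sub_distrib]
    exact Finset.sum_congr rfl fun i _ => by ring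
  -- the extended state
  set X : ℝ → Fin n → ℝ := fun t j => x t j + ∑ i, k i * (y' i j : ℝ) * (G i t - G i (t - τ i))
    with hX
  have hc0 : ∀ i j, 0 ≤ k i * (y' i j : ℝ) := fun i j => by have := hk i; positivity
  have hxX : ∀ t j, x t j ≤ X t j := by
    intro t j
    have : 0 ≤ ∑ i, k i * (y' i j : ℝ) * (G i t - G i (t - τ i)) :=
      Finset.sum_nonneg fun i _ => mul_nonneg (hc0 i j)
        (sub_nonneg.2 (hGm i _ _ (by linarith [hτ i])))
    simp only [hX]
    linarith
  have hX0 : ∀ t j, 0 ≤ X t j := fun t j => (h0 t j).trans (hxX t j)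
  have hGsh : ∀ i t, HasDerivAt (fun s => G i (s - τ i)) (mono (x (t - τ i)) (y i)) t := by
    intro i t
    exact (hG i (t - τ i)).comp_sub_const t (τ i)
  -- lower bound by the extended state
  have hlow0 : ∀ t ≥ (0:ℝ), ∀ s ≥ t, ∀ j, x t j + ∑ i, k i * (y' i j : ℝ) *
      (G i (s - τ i) - G i (t - τ i)) ≤ Real.exp (A * (s - t)) * x s j := by
    intro t ht s hs j
    set Z : ℝ → ℝ := fun w => Real.exp (A * (w - t)) * x w j -
      ∑ i, k i * (y' i j : ℝ) * G i (w - τ i) with hZ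
    have hE : ∀ w, HasDerivAt (fun w => Real.exp (A * (w - t))) (Real.exp (A * (w - t)) * A) w := by
      intro w
      have : HasDerivAt (fun w => A * (w - t)) A w := by
        simpa using ((hasDerivAt_id w).sub_const t).const_mul A
      exact this.exp
    have hder : ∀ w > (0:ℝ), HasDerivAt Z ((Real.exp (A * (w - t)) * A * x w j +
        Real.exp (A * (w - t)) * ((∑ i, k i * (y' i j : ℝ) * mono (x (w - τ i)) (y i)) -
        ∑ i, k i * (mono (x w) (y i) * (y i j : ℝ)))) -
        ∑ i, k i * (y' i j : ℝ) * mono (x (w - τ i)) (y i)) w := by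
      intro w hw
      have h1 := hd w hw j
      rw [hsplit] at h1
      have h2 : HasDerivAt (fun w => ∑ i, k i * (y' i j : ℝ) * G i (w - τ i))
          (∑ i, k i * (y' i j : ℝ) * mono (x (w - τ i)) (y i)) w :=
        HasDerivAt.fun_sum fun i _ => (hGsh i w).const_mul _
      exact ((hE w).mul h1).sub h2
    have hZc : Continuous Z := by
      have h2 : ∀ i, Continuous (fun w => G i (w - τ i)) := fun i =>
        continuous_iff_continuousAt.2 fun w => (hGsh i w).continuousAt
      exact ((Real.continuous_exp.comp (continuous_const.mul
        (continuous_id.sub continuous_const))).mul (hcj j)).sub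
        (continuous_finsetSum _ fun i _ => continuous_const.mul (h2 i))
    have hfin := gac_mono_deriv Z _ t s hs hZc.continuousOn
      (fun w hw => hder w (lt_of_le_of_lt ht hw.1)) (fun w hw => by
        have h1 := hloss w j
        have h2 : 0 ≤ ∑ i, k i * (y' i j : ℝ) * mono (x (w - τ i)) (y i) :=
          Finset.sum_nonneg fun i _ => mul_nonneg (hc0 i j) (hu0 i _)
        have h3 : 1 ≤ Real.exp (A * (w - t)) :=
          Real.one_le_exp (mul_nonneg hA0 (by linarith [hw.1]))
        nlinarith [mul_nonneg (sub_nonneg.2 h3) h2,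
          mul_nonneg (by linarith : 0 ≤ Real.exp (A * (w - t))) (sub_nonneg.2 h1)])
    simp only [hZ, sub_self, mul_zero, Real.exp_zero, one_mul] at hfin
    simp only [mul_sub, Finset.sum_sub_distrib] at hfin ⊢
    linarith
  have hlow1 : ∀ t ≥ (0:ℝ), ∀ s ≥ t, ∀ j, x t j ≤ Real.exp (A * (s - t)) * x s j := by
    intro t ht s hs j
    have h1 := hlow0 t ht s hs j
    have : 0 ≤ ∑ i, k i * (y' i j : ℝ) * (G i (s - τ i) - G i (t - τ i)) :=
      Finset.sum_nonneg fun i _ => mul_nonneg (hc0 i j)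
        (sub_nonneg.2 (hGm i _ _ (by linarith)))
    linarith
  have hlow2 : ∀ t ≥ (0:ℝ), ∀ s ≥ t + τm, ∀ j, X t j ≤ Real.exp (A * (s - t)) * x s j := by
    intro t ht s hs j
    refine le_trans ?_ (hlow0 t ht s (by linarith) j)
    simp only [hX]
    refine add_le_add le_rfl (Finset.sum_le_sum fun i _ => mul_le_mul_of_nonneg_left ?_ (hc0 i j))
    have := hGm i t (s - τ i) (by linarith [hτm i])
    linarith
  have hpos : ∀ t ≥ (0:ℝ), ∀ j, 0 < x t j := by
    intro t ht j
    have h1 := hlow1 0 le_rfl t ht j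
    have h2 := hinit j
    by_contra hcon
    have h3 : x t j = 0 := le_antisymm (not_lt.1 hcon) (h0 t j)
    rw [h3, mul_zero] at h1
    linarith
  set L : ℝ := τm + 1 with hL
  have hL0 : 0 ≤ L := by linarith
  set E : ℝ := Real.exp (A * L) with hE
  have hE1 : 1 ≤ E := Real.one_le_exp (mul_nonneg hA0 hL0)
  have hEle : ∀ d, d ≤ L → Real.exp (A * d) ≤ E := fun d hd =>
    Real.exp_le_exp.2 (mul_le_mul_of_nonneg_left hd hA0)
  -- increment identity
  have hinc : ∀ t ≥ (0:ℝ), ∀ j, X (t + L) j = X t j +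
      ∑ i, (k i * (G i (t + L) - G i t)) * ((y' i j : ℝ) - y i j) := by
    intro t ht j
    set Q : ℝ → ℝ := fun w => X w j - ∑ i, k i * ((y' i j : ℝ) - y i j) * G i w with hQ
    have hder : ∀ w > (0:ℝ), HasDerivAt Q 0 w := by
      intro w hw
      have h2 : HasDerivAt (fun w => ∑ i, k i * (y' i j : ℝ) * (G i w - G i (w - τ i)))
          (∑ i, k i * (y' i j : ℝ) * (mono (x w) (y i) - mono (x (w - τ i)) (y i))) w :=
        HasDerivAt.fun_sum fun i _ => ((hG i w).sub (hGsh i w)).const_mul _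
      have h3 : HasDerivAt (fun w => ∑ i, k i * ((y' i j : ℝ) - y i j) * G i w)
          (∑ i, k i * ((y' i j : ℝ) - y i j) * mono (x w) (y i)) w :=
        HasDerivAt.fun_sum fun i _ => (hG i w).const_mul _
      have h4 := ((hd w hw j).add h2).sub h3
      refine h4.congr_deriv ?_
      rw [← Finset.sum_add_distrib, ← Finset.sum_sub_distrib]
      exact Finset.sum_eq_zero fun i _ => by ring
    have hQc : Continuous Q := by
      have h2 : ∀ i, Continuous (fun w => G i (w - τ i)) := fun i =>
        continuous_iff_continuousAt.2 fun w => (hGsh i w).continuousAt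
      have h3 : ∀ i, Continuous (G i) := fun i =>
        continuous_iff_continuousAt.2 fun w => (hG i w).continuousAt
      exact ((hcj j).add (continuous_finsetSum _ fun i _ =>
        continuous_const.mul ((h3 i).sub (h2 i)))).sub
        (continuous_finsetSum _ fun i _ => continuous_const.mul (h3 i))
    have e1 := gac_mono_deriv Q (fun _ => 0) t (t + L) (by linarith) hQc.continuousOn
      (fun w hw => hder w (lt_of_le_of_lt ht hw.1)) (fun _ _ => le_rfl)
    have e2 := gac_mono_deriv (fun w => - Q w) (fun _ => 0) t (t + L) (by linarith)
      hQc.neg.continuousOn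
      (fun w hw => by simpa using (hder w (lt_of_le_of_lt ht hw.1)).fun_neg) (fun _ _ => le_rfl)
    have e3 : Q t = Q (t + L) := le_antisymm e1 (by linarith)
    simp only [hQ] at e3
    have e4 : ∑ i, (k i * (G i (t + L) - G i t)) * ((y' i j : ℝ) - y i j) =
        ∑ i, k i * ((y' i j : ℝ) - y i j) * G i (t + L) -
        ∑ i, k i * ((y' i j : ℝ) - y i j) * G i t := by
      rw [← Finset.sum_sub_distrib]
      exact Finset.sum_congr rfl fun i _ => by ring
    rw [e4]
    linarith
  -- the comparison constant
  set a1 : ℝ := ∑ j, ∑ i, k i * (y' i j : ℝ) * (M ^ (∑ j, y i j) * τm) with ha1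
  set a2 : ℝ := ∑ i, E ^ (∑ j, y i j) / k i with ha2
  set a3 : ℝ := ∑ i, k i * (L * E ^ (∑ j, y i j)) with ha3
  have hE0 : 0 < E := by linarith
  have hn1 : ∀ i j, 0 ≤ k i * (y' i j : ℝ) * (M ^ (∑ j, y i j) * τm) := fun i j =>
    mul_nonneg (hc0 i j) (by positivity)
  have hn2 : ∀ i, 0 ≤ E ^ (∑ j, y i j) / k i := fun i => by have := hk i; positivity
  have hn3 : ∀ i, 0 ≤ k i * (L * E ^ (∑ j, y i j)) := fun i => by have := hk i; positivity
  have ha1n : 0 ≤ a1 := Finset.sum_nonneg fun j _ => Finset.sum_nonneg fun i _ => hn1 i j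
  have ha2n : 0 ≤ a2 := Finset.sum_nonneg fun i _ => hn2 i
  have ha3n : 0 ≤ a3 := Finset.sum_nonneg fun i _ => hn3 i
  have hs2 : ∀ i, E ^ (∑ j, y i j) / k i ≤ a2 := fun i =>
    Finset.single_le_sum (f := fun i => E ^ (∑ j, y i j) / k i)
      (fun i _ => hn2 i) (Finset.mem_univ i)
  have hs3 : ∀ i, k i * (L * E ^ (∑ j, y i j)) ≤ a3 := fun i =>
    Finset.single_le_sum (f := fun i => k i * (L * E ^ (∑ j, y i j)))
      (fun i _ => hn3 i) (Finset.mem_univ i)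
  have hXM : ∀ t j, X t j ≤ M + a1 := by
    intro t j
    have h1 : ∑ i, k i * (y' i j : ℝ) * (M ^ (∑ j, y i j) * τm) ≤ a1 :=
      Finset.single_le_sum
        (f := fun j => ∑ i, k i * (y' i j : ℝ) * (M ^ (∑ j, y i j) * τm))
        (fun j _ => Finset.sum_nonneg fun i _ => hn1 i j) (Finset.mem_univ j)
    simp only [hX]
    refine add_le_add (hxM t j) (le_trans (Finset.sum_le_sum fun i _ => ?_) h1)
    refine mul_le_mul_of_nonneg_left ?_ (hc0 i j)
    have h2 := (gac_mvt (G i) _ (hG i) (t - τ i) t 0 _ (by linarith [hτ i])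
      (fun s _ => ⟨hu0 i s, huM i s⟩)).2
    refine h2.trans (mul_le_mul_of_nonneg_left ?_ (by positivity))
    linarith [hτm i]
  set Mc : ℝ := M + a1 + E + a2 + a3 with hMcd
  -- initial lower bound
  obtain ⟨μ, hμ, hμX⟩ : ∃ μ > 0, ∀ t ∈ Set.Icc (0:ℝ) L, ∀ j, μ ≤ x t j := by
    have hj : ∀ j, ∃ m > 0, ∀ t ∈ Set.Icc (0:ℝ) L, m ≤ x t j := by
      intro j
      refine ⟨x 0 j / E, div_pos (hinit j) hE0, fun t ht => ?_⟩
      rw [div_le_iff₀ hE0]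
      have h1 := hlow1 0 le_rfl t ht.1 j
      have h2 := mul_le_mul_of_nonneg_right (hEle (t - 0) (by linarith [ht.2])) (h0 t j)
      linarith
    choose m hm hm2 using hj
    rcases isEmpty_or_nonempty (Fin n) with he | he
    · exact ⟨1, one_pos, fun t _ j => (he.false j).elim⟩
    · obtain ⟨j0, h3⟩ := Finite.exists_min m
      exact ⟨m j0, hm j0, fun t ht j => (h3 j).trans (hm2 j t ht)⟩
  obtain ⟨B, δ, hδ, hBδ, hBμ, hstep⟩ := gac_barrier y y' f hf hbal Mc μ (by linarith) hμ
  have hnext : ∀ t ≥ (0:ℝ), B (X t) → B (X (t + L)) := by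
    intro t ht hB
    have hxs : ∀ s ∈ Set.Icc t (t + L), ∀ j, x s j ≤ E * X (t + L) j := by
      intro s hs j
      have h1 := hlow1 s (ht.trans hs.1) (t + L) hs.2 j
      have h2 := mul_le_mul_of_nonneg_right (hEle (t + L - s) (by linarith [hs.1])) (h0 (t + L) j)
      have h3 := mul_le_mul_of_nonneg_left (hxX (t + L) j) hE0.le
      linarith
    have hXs : ∀ s ∈ Set.Icc (t + τm) (t + L), ∀ j, X t j ≤ E * x s j := by
      intro s hs j
      have h1 := hlow2 t ht s hs.1 j
      have h2 := mul_le_mul_of_nonneg_right (hEle (s - t) (by linarith [hs.2])) (h0 s j)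
      linarith
    refine hstep (X t) (X (t + L)) (fun i => k i * (G i (t + L) - G i t)) (hX0 _) (hX0 _)
      (fun j => (hXM _ j).trans (by linarith)) ?_ ?_ ?_ (fun j => hinc t ht j) hB
    · intro j
      have h1 := hXs (t + L) ⟨by linarith, le_rfl⟩ j
      have h2 := mul_le_mul_of_nonneg_left (hxX (t + L) j) hE0.le
      have h3 := mul_le_mul_of_nonneg_right (by linarith : E ≤ Mc) (hX0 (t + L) j)
      linarith
    · intro i
      have hki := hk i
      have hP : 0 < E ^ (∑ j, y i j) := by positivity
      have h1 : ∀ s ∈ Set.Icc (t + τm) (t + L),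
          mono (X t) (y i) / E ^ (∑ j, y i j) ≤ mono (x s) (y i) := by
        intro s hs
        rw [div_le_iff₀ hP, mul_comm, ← gac_mono_scale]
        exact gac_mono_mono _ _ _ (hX0 t) (hXs s hs)
      have h2 := (gac_mvt (G i) _ (hG i) (t + τm) (t + L) _ _ (by linarith)
        (fun s hs => ⟨h1 s hs, huM i s⟩)).1
      have h3 : t + L - (t + τm) = 1 := by rw [hL]; ring
      rw [h3, mul_one, div_le_iff₀ hP] at h2
      have h4 := hGm i t (t + τm) (by linarith)
      have h5 : 0 ≤ G i (t + L) - G i t := sub_nonneg.2 (hGm i _ _ (by linarith))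
      calc mono (X t) (y i) ≤ (G i (t + L) - G i t) * E ^ (∑ j, y i j) :=
            h2.trans (mul_le_mul_of_nonneg_right (by linarith) hP.le)
        _ = (E ^ (∑ j, y i j) / k i) * (k i * (G i (t + L) - G i t)) := by
            field_simp
        _ ≤ Mc * (k i * (G i (t + L) - G i t)) :=
            mul_le_mul_of_nonneg_right ((hs2 i).trans (by linarith)) (mul_nonneg hki.le h5)
    · intro i
      have hki := hk i
      have h1 : ∀ s ∈ Set.Icc t (t + L),
          mono (x s) (y i) ≤ E ^ (∑ j, y i j) * mono (X (t + L)) (y i) := by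
        intro s hs
        rw [← gac_mono_scale]
        exact gac_mono_mono _ _ _ (h0 s) (hxs s hs)
      have h2 := (gac_mvt (G i) _ (hG i) t (t + L) 0 _ (by linarith)
        (fun s hs => ⟨hu0 i s, h1 s hs⟩)).2
      have h3 : 0 ≤ mono (X (t + L)) (y i) := gac_mono_nonneg _ _ (hX0 _)
      calc k i * (G i (t + L) - G i t)
          ≤ k i * (E ^ (∑ j, y i j) * mono (X (t + L)) (y i) * (t + L - t)) :=
            mul_le_mul_of_nonneg_left h2 hki.le
        _ = (k i * (L * E ^ (∑ j, y i j))) * mono (X (t + L)) (y i) := by ring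
        _ ≤ Mc * mono (X (t + L)) (y i) :=
            mul_le_mul_of_nonneg_right ((hs3 i).trans (by linarith)) h3
  have hall : ∀ N : ℕ, ∀ t ∈ Set.Icc (0:ℝ) L, B (X (t + N * L)) := by
    intro N
    induction N with
    | zero =>
      intro t ht
      simp only [Nat.cast_zero, zero_mul, add_zero]
      exact hBμ _ fun j => (hμX t ht j).trans (hxX t j)
    | succ N ih =>
      intro t ht
      have h1 := hnext (t + N * L) (by have := ht.1; positivity) (ih t ht)
      have h2 : t + ((N + 1 : ℕ) : ℝ) * L = t + N * L + L := by push_cast; ring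
      rw [h2]
      exact h1
  have hL1 : 0 < L := by linarith
  have hBall : ∀ t ≥ (0:ℝ), B (X t) := by
    intro t ht
    have h1 := Nat.floor_le (div_nonneg ht hL0)
    have h2 := Nat.lt_floor_add_one (t / L)
    rw [le_div_iff₀ hL1] at h1
    rw [div_lt_iff₀ hL1] at h2
    have h3 := hall ⌊t / L⌋₊ (t - ⌊t / L⌋₊ * L) ⟨by linarith, by linarith⟩
    simpa using h3
  refine ⟨δ / E, div_pos hδ hE0, L, fun t ht j => ?_⟩
  rw [div_le_iff₀ hE0]
  have h1 := hBδ _ (hBall (t - L) (by linarith)) j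
  have h2 := hlow2 (t - L) (by linarith) t (by linarith) j
  have h3 : A * (t - (t - L)) = A * L := by ring
  rw [h3] at h2
  linarith

theorem gac_main {n r : ℕ} (y y' : Fin r → Fin n → ℕ) (k τ : Fin r → ℝ) (τm : ℝ)
    (hk : ∀ i, 0 < k i) (hτ : ∀ i, 0 ≤ τ i) (hτm : ∀ i, τ i ≤ τm) (hτm0 : 0 ≤ τm)
    (hCB : ComplexBalancedOn y y' k Finset.univ) : Persistent y y' k τ τm := by
  intro x hx hpi hbd j
  obtain ⟨hx0, hxc, hxd⟩ := hx
  obtain ⟨M, hM⟩ := hbd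
  obtain ⟨xb, hxb, hb⟩ := hCB
  have hmono : ∀ i, 0 < mono xb (y i) := fun i => by
    unfold mono
    exact Finset.prod_pos fun j _ => pow_pos (hxb j) _
  have hmem : ∀ t, max t (-τm) ∈ Set.Ici (-τm) := fun t =>
    Set.mem_Ici.2 (le_max_right _ _)
  have hle : ∀ t ∈ Set.Ici (-τm), ∀ j, x t j ≤ max M 1 := fun t ht j =>
    ((le_abs_self _).trans ((norm_le_pi_norm (x t) j).trans (hM t ht))).trans (le_max_left _ _)
  have heq : ∀ t, -τm ≤ t → x (max t (-τm)) = x t := fun t ht => by rw [max_eq_left ht]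
  obtain ⟨ε, hε, T, hT⟩ := gac_core y y' k τ τm hk hτ hτm hτm0
    (fun i => k i * mono xb (y i)) (fun i => mul_pos (hk i) (hmono i))
    (gac_bal y y' _ (fun η => hb η)) (fun t => x (max t (-τm))) (max M 1) (le_max_right _ _)
    (hxc.comp_continuous (by fun_prop) hmem)
    (fun t j => hx0 _ (hmem t) j) (fun t j => hle _ (hmem t) j)
    (fun j => by
      rw [heq 0 (by linarith)]
      exact hpi 0 ⟨by linarith, le_rfl⟩ j)
    (fun t ht j => by
      have h1 := (hasDerivAt_pi.1 (hxd t ht)) j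
      simp only [heq t (by linarith), fun i => heq (t - τ i) (by linarith [hτm i])]
      refine h1.congr_of_eventuallyEq ?_
      filter_upwards [lt_mem_nhds ht] with s hs
      rw [heq s (by linarith)])
  refine lt_of_lt_of_le hε (Filter.le_liminf_of_le ?_ ?_)
  · refine Filter.IsBoundedUnder.isCoboundedUnder_ge ⟨max M 1, ?_⟩
    rw [Filter.eventually_map]
    filter_upwards [Filter.eventually_ge_atTop (-τm)] with t ht
    exact hle t ht j
  · filter_upwards [Filter.eventually_ge_atTop (-τm), Filter.eventually_ge_atTop T] with t h1 h2
    have := hT t h2 j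
    simp only [heq t h1] at this
    exact this

theorem stmt13 {n r l : ℕ} (y y' : Fin r → Fin n → ℕ)
    (k τ : Fin r → ℝ) (τm : ℝ)
    (hk : ∀ i, 0 < k i) (hτ : ∀ i, 0 ≤ τ i) (hτm : ∀ i, τ i ≤ τm) (hτm0 : 0 ≤ τm)
    (hCB : ComplexBalancedOn y y' k Finset.univ)
    (Sp : Fin l → Set (Fin n)) (grp : Fin r → Fin l)
    (hcomb : IsCombination y y' Sp grp)
    (hsubCB : ∀ p, ComplexBalancedOn y y' k (Rgrp grp p))
    (h2d : ∀ p, Module.finrank ℝ (stoichOn y y' (Rgrp grp p)) = 2)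
    (hcase : ∀ W : Set (Fin n), Semilocking y y' Finset.univ W → W ≠ Set.univ →
      (W ∩ interSpecies Sp = ∅) ∨
      (∀ p, W ∩ Sp p = ∅ ∨ (Semilocking y y' (Rgrp grp p) (W ∩ Sp p) ∧
        FacetType (stoichOn y y' (Rgrp grp p)) (W ∩ Sp p))) ∨
      ((∀ j, j ∉ W → j ∈ Wtf y y' W ∪ Wtr y y' W) ∧ (Wtf y y' W).Nonempty)) :
    Persistent y y' k τ τm := by
  exact gac_main y y' k τ τm hk hτ hτm hτm0 hCB
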